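/- arXiv:2210.14798 — 2 statements merged into one kernel-verified Lean document; each statement's English description precedes it below -/
import Mathlib

section
/- Let n ∈ ℕ with n ≥ 1 and let f be a polynomial of degree at most n. Then sup_{z ∈ ℂ} u_f(z) ≤ ‖f‖_{P_n}, with equality if and only if either f = 0 or ‖f‖_{P_n}⁻¹ f ∈ M₂. -/
open MeasureTheory

/-- `u_f(z) = |f(z)| (1+|z|²)^{−n/2}` for a polynomial `f`. -/
noncomputable def uPoly (n : ℕ) (f : Polynomial ℂ) (z : ℂ) : ℝ :=
  ‖f.eval z‖ * (1 + ‖z‖^2) ^ (-(n:ℝ)/2)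

/-- The squared norm `‖f‖_{P_n}² = ((n+1)/π) ∫_ℂ |f(z)|² (1+|z|²)^{−n−2} dA(z)`. -/
noncomputable def polyNormSq (n : ℕ) (f : Polynomial ℂ) : ℝ :=
  ((n:ℝ)+1)/Real.pi * ∫ z : ℂ, ‖f.eval z‖^2 * (1 + ‖z‖^2) ^ (-(n:ℝ)-2)

/-- The optimizer set `M₂`: the polynomials whose values are
`e^{iθ} (1 + conj(w) z)^n / (1+|w|²)^{n/2}` or `e^{iθ} z^n`. -/
def polyOpt (n : ℕ) : Set (Polynomial ℂ) :=
  {f | ∃ θ : ℝ,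
    (∃ w : ℂ, ∀ z : ℂ, f.eval z =
      Complex.exp (Complex.I * (θ:ℂ)) * (1 + (starRingEnd ℂ) w * z)^n /
        ((((1 + ‖w‖^2) ^ ((n:ℝ)/2) : ℝ)) : ℂ)) ∨
    (∀ z : ℂ, f.eval z = Complex.exp (Complex.I * (θ:ℂ)) * z^n)}

/-! ### Radial moments -/

theorem integrable_pow_mul_weight (n i : ℕ) (hi : i ≤ 2 * n) :
    Integrable (fun z : ℂ => ‖z‖ ^ i * ((1 + ‖z‖ ^ 2) ^ (n + 2))⁻¹) := by
  have h := integrable_rpow_neg_one_add_norm_sq (E := ℂ) (μ := volume) (r := 4)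
    (by rw [Complex.finrank_real_complex]; norm_num)
  refine h.mono' (Continuous.aestronglyMeasurable ?_) (Filter.Eventually.of_forall fun z => ?_)
  · exact (by fun_prop : Continuous fun z : ℂ => ‖z‖ ^ i).mul
      (Continuous.inv₀ (by fun_prop) fun z => by positivity)
  · have hpos : 0 < 1 + ‖z‖ ^ 2 := by positivity
    have h1 : ‖z‖ ^ i ≤ (1 + ‖z‖ ^ 2) ^ n := by
      have hs : 1 ≤ √(1 + ‖z‖ ^ 2) := Real.one_le_sqrt.mpr (by nlinarith [sq_nonneg ‖z‖])
      calc ‖z‖ ^ i ≤ √(1 + ‖z‖ ^ 2) ^ i := by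
            gcongr
            exact Real.le_sqrt_of_sq_le (by linarith)
        _ ≤ √(1 + ‖z‖ ^ 2) ^ (2 * n) := pow_le_pow_right₀ hs hi
        _ = _ := by rw [pow_mul, Real.sq_sqrt hpos.le]
    have h2 : (1 + ‖z‖ ^ 2) ^ (-(4 : ℝ) / 2) = ((1 + ‖z‖ ^ 2) ^ 2)⁻¹ := by
      rw [show (-(4 : ℝ) / 2) = -((2 : ℕ) : ℝ) by norm_num, Real.rpow_neg hpos.le,
        Real.rpow_natCast]
    rw [h2, Real.norm_of_nonneg (by positivity), ← div_eq_mul_inv, div_le_iff₀ (by positivity),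
      pow_add]
    calc ‖z‖ ^ i ≤ (1 + ‖z‖ ^ 2) ^ n := h1
      _ = _ := by field_simp

theorem integral_radial (g : ℝ → ℝ) :
    ∫ z : ℂ, g ‖z‖ = 2 * Real.pi * ∫ r in Set.Ioi (0 : ℝ), r * g r := by
  have h := integral_fun_norm_addHaar (volume : Measure ℂ) g
  simpa [Complex.finrank_real_complex, Measure.real, mul_assoc] using h

theorem integrableOn_radial (n i : ℕ) (hi : i ≤ 2 * n) :
    IntegrableOn (fun r : ℝ => r * (r ^ i * ((1 + r ^ 2) ^ (n + 2))⁻¹)) (Set.Ioi 0) := by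
  have h := (integrable_fun_norm_addHaar (volume : Measure ℂ)
    (f := fun r : ℝ => r ^ i * ((1 + r ^ 2) ^ (n + 2))⁻¹)).1 (integrable_pow_mul_weight n i hi)
  simpa [Complex.finrank_real_complex] using h

theorem hasDerivAt_pow_div (n k : ℕ) (r : ℝ) :
    HasDerivAt (fun r : ℝ => r ^ (2 * k + 2) * ((1 + r ^ 2) ^ (n + 1))⁻¹)
      (2 * (k + 1) * (r * (r ^ (2 * k) * ((1 + r ^ 2) ^ (n + 2))⁻¹)) -
        2 * ((n : ℝ) - k) * (r * (r ^ (2 * (k + 1)) * ((1 + r ^ 2) ^ (n + 2))⁻¹))) r := by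
  have hne : (1 + r ^ 2) ≠ 0 := by positivity
  have h1 : HasDerivAt (fun r : ℝ => (1 + r ^ 2) ^ (n + 1))
      (((n + 1 : ℕ) : ℝ) * (1 + r ^ 2) ^ n * (2 * r)) r := by
    simpa using ((hasDerivAt_pow 2 r).const_add 1).fun_pow (n + 1)
  have h := (hasDerivAt_pow (2 * k + 2) r).fun_mul (h1.fun_inv (pow_ne_zero _ hne))
  refine h.congr_deriv ?_
  simp only [Nat.add_succ_sub_one, mul_add, mul_one, pow_add, pow_one]
  push_cast
  field_simp
  ring

theorem tendsto_pow_div_atTop (n k : ℕ) (hk : k < n) :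
    Filter.Tendsto (fun r : ℝ => r ^ (2 * k + 2) * ((1 + r ^ 2) ^ (n + 1))⁻¹)
      Filter.atTop (nhds 0) := by
  have h0 : Filter.Tendsto (fun r : ℝ => (1 + r ^ 2)⁻¹) Filter.atTop (nhds 0) :=
    (Filter.tendsto_atTop_add_const_left _ _ (Filter.tendsto_pow_atTop two_ne_zero)).inv_tendsto_atTop
  refine squeeze_zero (fun r => ?_) (fun r => ?_) h0
  · rw [show 2 * k + 2 = 2 * (k + 1) by ring, pow_mul]
    positivity
  have h1 : 1 ≤ 1 + r ^ 2 := by nlinarith [sq_nonneg r]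
  have hpos : 0 < 1 + r ^ 2 := by positivity
  have : r ^ (2 * k + 2) ≤ (1 + r ^ 2) ^ n := by
    calc r ^ (2 * k + 2) = (r ^ 2) ^ (k + 1) := by rw [← pow_mul]; ring_nf
      _ ≤ (1 + r ^ 2) ^ (k + 1) := by gcongr; linarith
      _ ≤ _ := pow_le_pow_right₀ h1 hk
  rw [← div_eq_mul_inv, div_le_iff₀ (by positivity), pow_succ' _ n]
  calc _ ≤ _ := this
    _ = _ := (inv_mul_cancel_left₀ hpos.ne' _).symm

theorem tendsto_pow_div_atTop_one (n : ℕ) :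
    Filter.Tendsto (fun r : ℝ => r ^ (2 * n + 2) * ((1 + r ^ 2) ^ (n + 1))⁻¹)
      Filter.atTop (nhds 1) := by
  have h0 : Filter.Tendsto (fun r : ℝ => (1 + r ^ 2)⁻¹) Filter.atTop (nhds 0) :=
    (Filter.tendsto_atTop_add_const_left _ _ (Filter.tendsto_pow_atTop two_ne_zero)).inv_tendsto_atTop
  have h := ((tendsto_const_nhds (x := (1 : ℝ))).sub h0).pow (n + 1)
  simp only [sub_zero, one_pow] at h
  refine h.congr fun r => ?_
  have hne : (1 + r ^ 2) ≠ 0 := by positivity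
  rw [← inv_pow, show 2 * n + 2 = 2 * (n + 1) by ring, pow_mul, ← mul_pow]
  congr 1
  field_simp
  ring

theorem radial_moment_succ (n k : ℕ) (hk : k < n) :
    (k + 1) * ∫ r in Set.Ioi (0 : ℝ), r * (r ^ (2 * k) * ((1 + r ^ 2) ^ (n + 2))⁻¹) =
      (n - k) * ∫ r in Set.Ioi (0 : ℝ), r * (r ^ (2 * (k + 1)) * ((1 + r ^ 2) ^ (n + 2))⁻¹) := by
  have i1 := (integrableOn_radial n (2 * k) (by omega)).const_mul (2 * ((k : ℝ) + 1))
  have i2 := (integrableOn_radial n (2 * (k + 1)) (by omega)).const_mul (2 * ((n : ℝ) - k))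
  have h := integral_Ioi_of_hasDerivAt_of_tendsto' (a := 0)
    (fun r _ => hasDerivAt_pow_div n k r) (i1.sub i2) (tendsto_pow_div_atTop n k hk)
  rw [integral_sub i1 i2, integral_const_mul, integral_const_mul] at h
  simp at h
  linarith

theorem radial_moment_top (n : ℕ) :
    2 * (n + 1) * ∫ r in Set.Ioi (0 : ℝ), r * (r ^ (2 * n) * ((1 + r ^ 2) ^ (n + 2))⁻¹) = 1 := by
  have h := integral_Ioi_of_hasDerivAt_of_tendsto' (a := 0)
    (f' := fun r => 2 * ((n : ℝ) + 1) * (r * (r ^ (2 * n) * ((1 + r ^ 2) ^ (n + 2))⁻¹)))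
    (fun r _ => (hasDerivAt_pow_div n n r).congr_deriv (by simp))
    ((integrableOn_radial n (2 * n) le_rfl).const_mul _) (tendsto_pow_div_atTop_one n)
  rw [integral_const_mul] at h
  simpa using h

theorem radial_moment (n k : ℕ) (hk : k ≤ n) :
    2 * (n + 1) * ∫ r in Set.Ioi (0 : ℝ), r * (r ^ (2 * k) * ((1 + r ^ 2) ^ (n + 2))⁻¹) =
      ((n.choose k : ℕ) : ℝ)⁻¹ := by
  induction hk using Nat.decreasingInduction with
  | self => simpa using radial_moment_top n
  | of_succ k hk ih =>
    have h := radial_moment_succ n k hk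
    have hc : ((n.choose (k + 1) : ℕ) : ℝ) * (k + 1) = n.choose k * (n - k) := by
      have := Nat.choose_succ_right_eq n k
      rw [← Nat.cast_sub hk.le]
      exact_mod_cast this
    have p1 : (0 : ℝ) < n.choose k := by exact_mod_cast Nat.choose_pos hk.le
    have p2 : (0 : ℝ) < n.choose (k + 1) := by exact_mod_cast Nat.choose_pos hk
    have p3 : (0 : ℝ) < k + 1 := by positivity
    apply eq_inv_of_mul_eq_one_left
    replace ih := (mul_eq_one_iff_eq_inv₀ p2.ne').2 ih
    apply mul_left_cancel₀ p3.ne'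
    calc _ = 2 * ((n : ℝ) + 1) * n.choose k * ((k + 1) * ∫ r in Set.Ioi (0 : ℝ),
            r * (r ^ (2 * k) * ((1 + r ^ 2) ^ (n + 2))⁻¹)) := by ring
      _ = (n.choose k * (n - k)) * (2 * ((n : ℝ) + 1) * ∫ r in Set.Ioi (0 : ℝ),
            r * (r ^ (2 * (k + 1)) * ((1 + r ^ 2) ^ (n + 2))⁻¹)) := by rw [h]; ring
      _ = (k + 1) * (2 * ((n : ℝ) + 1) * (∫ r in Set.Ioi (0 : ℝ),
            r * (r ^ (2 * (k + 1)) * ((1 + r ^ 2) ^ (n + 2))⁻¹)) * n.choose (k + 1)) := by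
          rw [← hc]; ring
      _ = _ := by rw [ih]

/-! ### The norm in terms of the coefficients -/

theorem integral_monomial_mul_conj (n j k : ℕ) (hjk : j ≠ k) :
    ∫ z : ℂ, z ^ j * (starRingEnd ℂ) z ^ k * (((1 + ‖z‖ ^ 2) ^ (n + 2))⁻¹ : ℝ) = 0 := by
  set c : Circle := Circle.exp (Real.pi / ((j : ℝ) - k)) with hc
  have hmp := (rotation c).measurePreserving
  have h := hmp.integral_comp (rotation c).toHomeomorph.measurableEmbedding
    (fun z : ℂ => z ^ j * (starRingEnd ℂ) z ^ k * (((1 + ‖z‖ ^ 2) ^ (n + 2))⁻¹ : ℝ))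
  have hcc : (c : ℂ) ^ j * (starRingEnd ℂ) (c : ℂ) ^ k = -1 := by
    have hne : (j : ℂ) - k ≠ 0 := sub_ne_zero.mpr (by exact_mod_cast hjk)
    rw [hc, Circle.coe_exp, ← Complex.exp_conj, ← Complex.exp_nat_mul, ← Complex.exp_nat_mul,
      ← Complex.exp_add, ← Complex.exp_pi_mul_I]
    congr 1
    simp only [map_mul, Complex.conj_ofReal, Complex.conj_I]
    push_cast
    field_simp
    ring
  have h2 : ∀ z : ℂ, (rotation c z) ^ j * (starRingEnd ℂ) (rotation c z) ^ k *
      (((1 + ‖rotation c z‖ ^ 2) ^ (n + 2))⁻¹ : ℝ) =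
      -(z ^ j * (starRingEnd ℂ) z ^ k * (((1 + ‖z‖ ^ 2) ^ (n + 2))⁻¹ : ℝ)) := by
    intro z
    rw [LinearIsometryEquiv.norm_map, rotation_apply, map_mul, mul_pow, mul_pow]
    linear_combination z ^ j * (starRingEnd ℂ) z ^ k * (((1 + ‖z‖ ^ 2) ^ (n + 2))⁻¹ : ℝ) * hcc
  simp only [h2] at h
  rw [integral_neg] at h
  linear_combination (-1 / 2 : ℂ) * h

theorem integral_monomial_mul_conj_self (n k : ℕ) (hk : k ≤ n) :
    ((n : ℂ) + 1) / Real.pi *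
      ∫ z : ℂ, z ^ k * (starRingEnd ℂ) z ^ k * (((1 + ‖z‖ ^ 2) ^ (n + 2))⁻¹ : ℝ) =
      ((n.choose k : ℕ) : ℂ)⁻¹ := by
  have h : ∀ z : ℂ, z ^ k * (starRingEnd ℂ) z ^ k * (((1 + ‖z‖ ^ 2) ^ (n + 2))⁻¹ : ℝ) =
      ((‖z‖ ^ (2 * k) * ((1 + ‖z‖ ^ 2) ^ (n + 2))⁻¹ : ℝ) : ℂ) := by
    intro z
    rw [← mul_pow, Complex.mul_conj']
    push_cast
    rw [pow_mul]
  simp only [h]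
  rw [integral_complex_ofReal, integral_radial (fun r => r ^ (2 * k) * ((1 + r ^ 2) ^ (n + 2))⁻¹)]
  have h2 := radial_moment n k hk
  have hpi := Real.pi_ne_zero
  have h3 : ((n : ℝ) + 1) / Real.pi * (2 * Real.pi * ∫ r in Set.Ioi (0 : ℝ),
      r * (r ^ (2 * k) * ((1 + r ^ 2) ^ (n + 2))⁻¹)) = ((n.choose k : ℕ) : ℝ)⁻¹ := by
    rw [← h2]; field_simp
  have h4 := congrArg Complex.ofReal h3
  push_cast at h4 ⊢
  exact h4

theorem integrable_monomial_mul_conj (n j k : ℕ) (hj : j ≤ n) (hk : k ≤ n) :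
    Integrable fun z : ℂ =>
      z ^ j * (starRingEnd ℂ) z ^ k * (((1 + ‖z‖ ^ 2) ^ (n + 2))⁻¹ : ℝ) := by
  refine (integrable_pow_mul_weight n (j + k) (by omega)).mono'
    (Continuous.aestronglyMeasurable ?_) (Filter.Eventually.of_forall fun z => le_of_eq ?_)
  · refine Continuous.mul (by fun_prop) (Complex.continuous_ofReal.comp ?_)
    exact Continuous.inv₀ (by fun_prop) fun z => by positivity
  · rw [norm_mul, norm_mul, norm_pow, norm_pow, RCLike.norm_conj, ← pow_add, Complex.norm_real,
      Real.norm_of_nonneg (by positivity)]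

theorem polyNormSq_eq_sum (n : ℕ) (f : Polynomial ℂ) (hf : f.natDegree ≤ n) :
    polyNormSq n f = ∑ k ∈ Finset.range (n + 1), ‖f.coeff k‖ ^ 2 / (n.choose k : ℝ) := by
  have hpt : ∀ z : ℂ, ((‖f.eval z‖ ^ 2 * (1 + ‖z‖ ^ 2) ^ (-(n : ℝ) - 2) : ℝ) : ℂ) =
      ∑ j ∈ Finset.range (n + 1), ∑ k ∈ Finset.range (n + 1),
        f.coeff j * (starRingEnd ℂ) (f.coeff k) *
          (z ^ j * (starRingEnd ℂ) z ^ k * (((1 + ‖z‖ ^ 2) ^ (n + 2))⁻¹ : ℝ)) := by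
    intro z
    have hpos : 0 ≤ 1 + ‖z‖ ^ 2 := by positivity
    rw [show (-(n : ℝ) - 2) = -((n + 2 : ℕ) : ℝ) by push_cast; ring, Real.rpow_neg hpos,
      Real.rpow_natCast, Complex.ofReal_mul, Complex.ofReal_pow, ← Complex.mul_conj',
      Polynomial.eval_eq_sum_range' (Nat.lt_succ_of_le hf), map_sum, Finset.sum_mul_sum,
      Finset.sum_mul]
    refine Finset.sum_congr rfl fun j _ => ?_
    rw [Finset.sum_mul]
    refine Finset.sum_congr rfl fun k _ => ?_
    rw [map_mul, map_pow]
    ring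
  have hint : ∀ j ∈ Finset.range (n + 1), ∀ k ∈ Finset.range (n + 1),
      Integrable fun z : ℂ => f.coeff j * (starRingEnd ℂ) (f.coeff k) *
          (z ^ j * (starRingEnd ℂ) z ^ k * (((1 + ‖z‖ ^ 2) ^ (n + 2))⁻¹ : ℝ)) :=
    fun j hj k hk => (integrable_monomial_mul_conj n j k
      (Nat.lt_succ_iff.1 (Finset.mem_range.1 hj))
      (Nat.lt_succ_iff.1 (Finset.mem_range.1 hk))).const_mul _
  apply Complex.ofReal_injective
  rw [polyNormSq, Complex.ofReal_mul, ← integral_complex_ofReal]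
  simp only [hpt]
  rw [integral_finsetSum _ fun j hj => integrable_finsetSum _ fun k hk => hint j hj k hk,
    Finset.mul_sum, Complex.ofReal_sum]
  refine Finset.sum_congr rfl fun j hj => ?_
  rw [integral_finsetSum _ fun k hk => hint j hj k hk,
    Finset.sum_eq_single_of_mem j hj fun k _ hkj => by
      rw [integral_const_mul, integral_monomial_mul_conj n j k hkj.symm, mul_zero],
    integral_const_mul]
  have h := integral_monomial_mul_conj_self n j (Nat.lt_succ_iff.1 (Finset.mem_range.1 hj))
  rw [Complex.ofReal_div _ (n.choose j : ℝ), Complex.ofReal_pow, ← Complex.mul_conj',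
    Complex.ofReal_natCast, div_eq_mul_inv (_ * _), ← h]
  push_cast
  ring

/-! ### The pointwise bound with its defect -/

/-- The Cauchy–Schwarz defect of the evaluation functional at `z`. -/
theorem sum_defect (n : ℕ) (f : Polynomial ℂ) (hf : f.natDegree ≤ n) (z : ℂ) :
    ∑ k ∈ Finset.range (n + 1), ‖f.coeff k - f.eval z / (((1 + ‖z‖ ^ 2) ^ n : ℝ) : ℂ) *
        (n.choose k : ℂ) * (starRingEnd ℂ) z ^ k‖ ^ 2 / (n.choose k : ℝ) =
      polyNormSq n f - ‖f.eval z‖ ^ 2 / (1 + ‖z‖ ^ 2) ^ n := by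
  set S : ℝ := (1 + ‖z‖ ^ 2) ^ n with hS
  have hS0 : (S : ℂ) ≠ 0 := by
    have : 0 < S := by positivity
    exact_mod_cast this.ne'
  set l : ℂ := f.eval z / (S : ℂ) with hl
  have hfz : f.eval z = l * S := by rw [hl]; field_simp
  have hsumS : ∑ k ∈ Finset.range (n + 1),
      (n.choose k : ℂ) * (z ^ k * (starRingEnd ℂ) z ^ k) = S := by
    rw [hS]
    push_cast
    rw [add_comm (1 : ℂ), add_pow]
    refine Finset.sum_congr rfl fun k _ => ?_
    rw [← mul_pow, Complex.mul_conj']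
    ring
  have hsumf : ∑ k ∈ Finset.range (n + 1), f.coeff k * z ^ k = l * S := by
    rw [← hfz, Polynomial.eval_eq_sum_range' (Nat.lt_succ_of_le hf)]
  have hsumfc : ∑ k ∈ Finset.range (n + 1),
      (starRingEnd ℂ) (f.coeff k) * (starRingEnd ℂ) z ^ k = (starRingEnd ℂ) l * S := by
    have := congrArg (starRingEnd ℂ) hsumf
    simpa only [map_sum, map_mul, map_pow, Complex.conj_ofReal] using this
  rw [polyNormSq_eq_sum n f hf]
  apply Complex.ofReal_injective
  push_cast
  have hterm : ∀ k ∈ Finset.range (n + 1),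
      ((‖f.coeff k - l * (n.choose k : ℂ) * (starRingEnd ℂ) z ^ k‖ : ℂ)) ^ 2 /
        (n.choose k : ℂ) = (‖f.coeff k‖ : ℂ) ^ 2 / (n.choose k : ℂ)
        - (starRingEnd ℂ) l * (f.coeff k * z ^ k)
        - l * ((starRingEnd ℂ) (f.coeff k) * (starRingEnd ℂ) z ^ k)
        + l * (starRingEnd ℂ) l * ((n.choose k : ℂ) * (z ^ k * (starRingEnd ℂ) z ^ k)) := by
    intro k hk
    have hc : (n.choose k : ℂ) ≠ 0 := by
      exact_mod_cast (Nat.choose_pos (Nat.lt_succ_iff.1 (Finset.mem_range.1 hk))).ne'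
    rw [← Complex.mul_conj', ← Complex.mul_conj']
    simp only [map_sub, map_mul, map_pow, Complex.conj_conj, map_natCast]
    field_simp
    ring
  rw [Finset.sum_congr rfl hterm, Finset.sum_add_distrib, Finset.sum_sub_distrib,
    Finset.sum_sub_distrib, ← Finset.mul_sum, ← Finset.mul_sum, ← Finset.mul_sum, hsumf, hsumfc,
    hsumS, ← Complex.mul_conj', hfz, map_mul, Complex.conj_ofReal]
  field_simp
  ring

theorem uPoly_nonneg (n : ℕ) (f : Polynomial ℂ) (z : ℂ) : 0 ≤ uPoly n f z := by
  unfold uPoly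
  positivity

theorem uPoly_sq (n : ℕ) (f : Polynomial ℂ) (z : ℂ) :
    uPoly n f z ^ 2 = ‖f.eval z‖ ^ 2 / (1 + ‖z‖ ^ 2) ^ n := by
  have hpos : 0 ≤ 1 + ‖z‖ ^ 2 := by positivity
  rw [uPoly, mul_pow, ← Real.rpow_mul_natCast hpos, div_eq_mul_inv (‖f.eval z‖ ^ 2),
    ← Real.rpow_natCast _ n, ← Real.rpow_neg hpos]
  congr 2
  push_cast
  ring

theorem uPoly_le (n : ℕ) (f : Polynomial ℂ) (hf : f.natDegree ≤ n) (z : ℂ) :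
    uPoly n f z ≤ Real.sqrt (polyNormSq n f) := by
  apply Real.le_sqrt_of_sq_le
  rw [uPoly_sq, ← sub_nonneg, ← sum_defect n f hf z]
  positivity

theorem bddAbove_range_uPoly (n : ℕ) (f : Polynomial ℂ) (hf : f.natDegree ≤ n) :
    BddAbove (Set.range (uPoly n f)) :=
  ⟨_, Set.forall_mem_range.2 (uPoly_le n f hf)⟩

theorem polyNormSq_nonneg (n : ℕ) (f : Polynomial ℂ) : 0 ≤ polyNormSq n f := by
  unfold polyNormSq
  positivity

theorem eval_eq_of_uPoly_eq (n : ℕ) (f : Polynomial ℂ) (hf : f.natDegree ≤ n) (w : ℂ)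
    (hw : uPoly n f w = Real.sqrt (polyNormSq n f)) (z : ℂ) :
    f.eval z = f.eval w / (((1 + ‖w‖ ^ 2) ^ n : ℝ) : ℂ) * (1 + (starRingEnd ℂ) w * z) ^ n := by
  have h := sum_defect n f hf w
  rw [← uPoly_sq, hw, Real.sq_sqrt (polyNormSq_nonneg n f), sub_self,
    Finset.sum_eq_zero_iff_of_nonneg fun k _ => by positivity] at h
  rw [Polynomial.eval_eq_sum_range' (Nat.lt_succ_of_le hf) z, add_comm (1 : ℂ),
    add_pow ((starRingEnd ℂ) w * z),
    Finset.mul_sum]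
  refine Finset.sum_congr rfl fun k hk => ?_
  have hc : (n.choose k : ℝ) ≠ 0 := by
    exact_mod_cast (Nat.choose_pos (Nat.lt_succ_iff.1 (Finset.mem_range.1 hk))).ne'
  have h1 := h k hk
  rw [div_eq_zero_iff, or_iff_left hc, sq_eq_zero_iff, norm_eq_zero, sub_eq_zero] at h1
  rw [h1, mul_pow]
  ring

/-! ### Behaviour at infinity -/

theorem continuous_uPoly (n : ℕ) (f : Polynomial ℂ) : Continuous (uPoly n f) :=
  f.continuous.norm.mul
    (Continuous.rpow_const (by fun_prop) fun z => Or.inl (by positivity))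

theorem uPoly_eq_uPoly_reflect_inv (n : ℕ) (f : Polynomial ℂ) (hf : f.natDegree ≤ n) {z : ℂ}
    (hz : z ≠ 0) : uPoly n f z = uPoly n (f.reflect n) z⁻¹ := by
  rw [← sq_eq_sq₀ (uPoly_nonneg n f z) (uPoly_nonneg n _ _), uPoly_sq, uPoly_sq]
  let _ := invertibleOfNonzero hz
  have h := Polynomial.eval₂_reflect_mul_pow (RingHom.id ℂ) z n f hf
  rw [invOf_eq_inv, ← Polynomial.eval, ← Polynomial.eval] at h
  have hz' : ‖z‖ ≠ 0 := norm_ne_zero_iff.2 hz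
  rw [← h, norm_mul, norm_pow, norm_inv, mul_pow, ← pow_mul, mul_comm n 2, pow_mul, mul_div_assoc,
    ← div_pow, div_eq_mul_inv (‖Polynomial.eval z⁻¹ (Polynomial.reflect n f)‖ ^ 2), ← inv_pow]
  congr 2
  field_simp
  ring

theorem tendsto_uPoly_cocompact (n : ℕ) (f : Polynomial ℂ) (hf : f.natDegree ≤ n) :
    Filter.Tendsto (uPoly n f) (Filter.cocompact ℂ) (nhds ‖f.coeff n‖) := by
  have h0 : uPoly n (f.reflect n) 0 = ‖f.coeff n‖ := by
    simp [uPoly, ← Polynomial.coeff_zero_eq_eval_zero, Polynomial.coeff_reflect,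
      Polynomial.revAt_le]
  have h := ((continuous_uPoly n (f.reflect n)).tendsto 0).comp
    (Filter.tendsto_inv₀_cobounded (α := ℂ))
  rw [h0] at h
  rw [← Metric.cobounded_eq_cocompact]
  refine h.congr' ?_
  filter_upwards [Bornology.eventually_ne_cobounded (0 : ℂ)] with z hz
  exact (uPoly_eq_uPoly_reflect_inv n f hf hz).symm

theorem norm_coeff_le_iSup_uPoly (n : ℕ) (f : Polynomial ℂ) (hf : f.natDegree ≤ n) :
    ‖f.coeff n‖ ≤ ⨆ z : ℂ, uPoly n f z :=
  le_of_tendsto (tendsto_uPoly_cocompact n f hf)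
    (Filter.Eventually.of_forall (le_ciSup (bddAbove_range_uPoly n f hf)))

/-- The supremum of `u_f` is attained, possibly at infinity. -/
theorem exists_uPoly_eq_iSup_or (n : ℕ) (f : Polynomial ℂ) (hf : f.natDegree ≤ n) :
    (∃ w, uPoly n f w = ⨆ z : ℂ, uPoly n f z) ∨ ‖f.coeff n‖ = ⨆ z : ℂ, uPoly n f z := by
  rcases (norm_coeff_le_iSup_uPoly n f hf).lt_or_eq with hlt | heq
  · obtain ⟨x₀, hx₀⟩ := exists_lt_of_lt_ciSup hlt
    obtain ⟨x, hx⟩ := (continuous_uPoly n f).exists_forall_ge' x₀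
      (((tendsto_uPoly_cocompact n f hf).eventually_lt_const hx₀).mono fun _ h => h.le)
    exact Or.inl ⟨x, le_antisymm (le_ciSup (bddAbove_range_uPoly n f hf) x) (ciSup_le hx)⟩
  · exact Or.inr heq

theorem eval_eq_of_norm_coeff_eq (n : ℕ) (f : Polynomial ℂ) (hf : f.natDegree ≤ n)
    (h : ‖f.coeff n‖ = Real.sqrt (polyNormSq n f)) (z : ℂ) :
    f.eval z = f.coeff n * z ^ n := by
  have h1 : ‖f.coeff n‖ ^ 2 = polyNormSq n f := by rw [h, Real.sq_sqrt (polyNormSq_nonneg n f)]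
  rw [polyNormSq_eq_sum n f hf, Finset.sum_range_succ, Nat.choose_self, Nat.cast_one, div_one,
    right_eq_add, Finset.sum_eq_zero_iff_of_nonneg fun k _ => by positivity] at h1
  rw [Polynomial.eval_eq_sum_range' (Nat.lt_succ_of_le hf) z, Finset.sum_range_succ,
    Finset.sum_eq_zero, zero_add]
  intro k hk
  have hc : (n.choose k : ℝ) ≠ 0 := by
    exact_mod_cast (Nat.choose_pos (Finset.mem_range.1 hk).le).ne'
  have h2 := h1 k hk
  rw [div_eq_zero_iff, or_iff_left hc, sq_eq_zero_iff, norm_eq_zero] at h2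
  rw [h2, zero_mul]

theorem eq_zero_of_polyNormSq_eq_zero (n : ℕ) (f : Polynomial ℂ) (hf : f.natDegree ≤ n)
    (h : polyNormSq n f = 0) : f = 0 := by
  refine Polynomial.funext fun z => ?_
  have h1 := uPoly_sq n f z
  have h2 := uPoly_le n f hf z
  rw [h, Real.sqrt_zero] at h2
  rw [le_antisymm h2 (uPoly_nonneg n f z), eq_comm, zero_pow two_ne_zero, div_eq_zero_iff,
    or_iff_left (by positivity), sq_eq_zero_iff, norm_eq_zero] at h1
  rw [h1, Polynomial.eval_zero]

theorem norm_exp_I_mul_arg_mul (c : ℂ) :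
    Complex.exp (Complex.I * (c.arg : ℂ)) * (‖c‖ : ℂ) = c := by
  rw [mul_comm, mul_comm Complex.I, Complex.norm_mul_exp_arg_mul_I]

theorem rpow_half_mul_self (n : ℕ) {x : ℝ} (hx : 0 < x) :
    x ^ ((n : ℝ) / 2) * x ^ ((n : ℝ) / 2) = x ^ n := by
  rw [← Real.rpow_add hx, add_halves, Real.rpow_natCast]

theorem inv_norm_mul_mem_polyOpt (n : ℕ) (f : Polynomial ℂ) (hf : f.natDegree ≤ n)
    (h0 : f ≠ 0) (h : (⨆ z : ℂ, uPoly n f z) = Real.sqrt (polyNormSq n f)) :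
    Polynomial.C (((Real.sqrt (polyNormSq n f) : ℝ) : ℂ))⁻¹ * f ∈ polyOpt n := by
  set s := Real.sqrt (polyNormSq n f) with hs
  have hs0 : 0 < s := Real.sqrt_pos.2 ((polyNormSq_nonneg n f).lt_of_ne' fun h1 =>
    h0 (eq_zero_of_polyNormSq_eq_zero n f hf h1))
  have hsC : (s : ℂ) ≠ 0 := by exact_mod_cast hs0.ne'
  rcases exists_uPoly_eq_iSup_or n f hf with ⟨w, hw⟩ | hw <;> rw [h] at hw
  · refine ⟨(f.eval w).arg, Or.inl ⟨w, fun z => ?_⟩⟩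
    have hpos : 0 < 1 + ‖w‖ ^ 2 := by positivity
    have hR := rpow_half_mul_self n hpos
    set R := (1 + ‖w‖ ^ 2) ^ ((n : ℝ) / 2) with hRdef
    have hR0 : 0 < R := Real.rpow_pos_of_pos hpos _
    have hRC : (R : ℂ) ≠ 0 := by exact_mod_cast hR0.ne'
    have hnorm : ‖f.eval w‖ = s * R := by
      rw [← hw, uPoly, neg_div, Real.rpow_neg hpos.le, ← hRdef, mul_assoc,
        inv_mul_cancel₀ hR0.ne', mul_one]
    have hev := norm_exp_I_mul_arg_mul (f.eval w)
    rw [hnorm] at hev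
    rw [Polynomial.eval_mul, Polynomial.eval_C, eval_eq_of_uPoly_eq n f hf w hw z, ← hR]
    nth_rewrite 1 [← hev]
    push_cast
    field_simp
  · refine ⟨(f.coeff n).arg, Or.inr fun z => ?_⟩
    have hev := norm_exp_I_mul_arg_mul (f.coeff n)
    rw [hw] at hev
    rw [Polynomial.eval_mul, Polynomial.eval_C, eval_eq_of_norm_coeff_eq n f hf hw z]
    nth_rewrite 1 [← hev]
    field_simp

theorem norm_exp_I_mul (θ : ℝ) : ‖Complex.exp (Complex.I * (θ : ℂ))‖ = 1 := by
  rw [mul_comm, Complex.norm_exp_ofReal_mul_I]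

theorem le_iSup_uPoly_of_mem_polyOpt (n : ℕ) (f : Polynomial ℂ) (hf : f.natDegree ≤ n) {s : ℝ}
    (hs : 0 < s) (h : Polynomial.C ((s : ℂ))⁻¹ * f ∈ polyOpt n) :
    s ≤ ⨆ z : ℂ, uPoly n f z := by
  have hsC : (s : ℂ) ≠ 0 := by exact_mod_cast hs.ne'
  have hfs : ∀ z, f.eval z = s * (Polynomial.C ((s : ℂ))⁻¹ * f).eval z := fun z => by
    rw [Polynomial.eval_mul, Polynomial.eval_C, mul_inv_cancel_left₀ hsC]
  obtain ⟨θ, ⟨w, hw⟩ | hw⟩ := h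
  · refine le_trans (le_of_eq ?_) (le_ciSup (bddAbove_range_uPoly n f hf) w)
    have hpos : 0 < 1 + ‖w‖ ^ 2 := by positivity
    have hR := rpow_half_mul_self n hpos
    set R := (1 + ‖w‖ ^ 2) ^ ((n : ℝ) / 2) with hRdef
    have hR0 : 0 < R := Real.rpow_pos_of_pos hpos _
    have hww : (1 + (starRingEnd ℂ) w * w) ^ n = ((R * R : ℝ) : ℂ) := by
      rw [hR, Complex.conj_mul']
      push_cast
      rfl
    rw [uPoly, hfs, hw, hww, neg_div, Real.rpow_neg hpos.le, ← hRdef, norm_mul, norm_div, norm_mul,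
      norm_exp_I_mul, Complex.norm_real, Complex.norm_real, Complex.norm_real,
      Real.norm_of_nonneg hs.le, Real.norm_of_nonneg hR0.le,
      Real.norm_of_nonneg (mul_pos hR0 hR0).le]
    field_simp
  · refine le_trans (le_of_eq ?_) (norm_coeff_le_iSup_uPoly n f hf)
    have hfe : f = Polynomial.C (s * Complex.exp (Complex.I * (θ : ℂ))) * Polynomial.X ^ n :=
      Polynomial.funext fun z => by
        rw [hfs, hw]
        simp [mul_assoc]
    rw [hfe, Polynomial.coeff_C_mul_X_pow, if_pos rfl, norm_mul, norm_exp_I_mul,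
      Complex.norm_real, Real.norm_of_nonneg hs.le, mul_one]

/-- **Lemma 2.2, Case 2.** For an integer `n ≥ 1` and a polynomial `f` of degree `≤ n`,
`sup_{z ∈ ℂ} u_f(z) ≤ ‖f‖_{P_n}`, with equality if and only if `f = 0` or
`‖f‖_{P_n}⁻¹ f ∈ M₂`. -/
theorem sup_uPoly_le (n : ℕ) (hn : 1 ≤ n) (f : Polynomial ℂ) (hf : f.natDegree ≤ n) :
    (⨆ z : ℂ, uPoly n f z) ≤ Real.sqrt (polyNormSq n f) ∧
    ((⨆ z : ℂ, uPoly n f z) = Real.sqrt (polyNormSq n f) ↔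
      f = 0 ∨ Polynomial.C (((Real.sqrt (polyNormSq n f) : ℝ) : ℂ))⁻¹ * f ∈ polyOpt n) := by
  have hle : (⨆ z : ℂ, uPoly n f z) ≤ Real.sqrt (polyNormSq n f) := ciSup_le (uPoly_le n f hf)
  refine ⟨hle, fun h => or_iff_not_imp_left.2 fun h0 => inv_norm_mul_mem_polyOpt n f hf h0 h, ?_⟩
  rintro (rfl | h)
  · simp [uPoly, polyNormSq]
  · refine le_antisymm hle ?_
    rcases (Real.sqrt_nonneg (polyNormSq n f)).eq_or_lt with h0 | h0
    · rw [← h0]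
      exact Real.iSup_nonneg (uPoly_nonneg n f)
    · exact le_iSup_uPoly_of_mem_polyOpt n f hf h0 h
end

section
/- Let f ∈ F²(ℂ) and for κ > 0 set μ(κ) := A({z ∈ ℂ : u_f(z) > κ}). Then the function κ ↦ −2 ln κ − μ(κ) is nondecreasing on (0, sup u_f). Moreover, if f ∈ M₁, then this function is constant on (0, sup u_f). -/
open MeasureTheory

/-- `u_f(z) = |f(z)| e^{−π|z|²/2}`. -/
noncomputable def uFock (f : ℂ → ℂ) (z : ℂ) : ℝ := ‖f z‖ * Real.exp (-Real.pi * ‖z‖^2 / 2)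

/-- The optimizer set `M₁`: the functions `z ↦ e^{iθ} e^{−π|w|²/2 + π conj(w) z}`. -/
def fockOpt : Set (ℂ → ℂ) :=
  {f | ∃ w : ℂ, ∃ θ : ℝ, f = fun z =>
    Complex.exp (Complex.I * (θ:ℂ)) *
      Complex.exp (((-Real.pi * ‖w‖^2 / 2 : ℝ) : ℂ) + (Real.pi : ℂ) * (starRingEnd ℂ) w * z)}

/-- The Lebesgue measure of the superlevel set `{u_f > κ}`. -/
noncomputable def muFock (f : ℂ → ℂ) (κ : ℝ) : ℝ :=
  (volume {z : ℂ | κ < uFock f z}).toReal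

theorem volume_add_volume_le_of_isCompact {A B C : Set ℝ} (hA : IsCompact A) (hB : IsCompact B)
    (hA₀ : A.Nonempty) (hB₀ : B.Nonempty) (h : ∀ a ∈ A, ∀ b ∈ B, a + b ∈ C) :
    volume A + volume B ≤ volume C := by
  obtain ⟨M, hM, hAM⟩ := hA.exists_isGreatest hA₀
  obtain ⟨m, hm, hBm⟩ := hB.exists_isLeast hB₀
  calc volume A + volume B = volume ((fun x => x + m) '' A) + volume ((fun x => M + x) '' B) := by
        rw [Set.image_add_left, Set.image_add_right, measure_preimage_add, measure_preimage_add_right]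
    _ = volume (((fun x => x + m) '' A) ∪ ((fun x => M + x) '' B)) := by
        refine (measure_union₀ (hB.image (by fun_prop)).measurableSet.nullMeasurableSet ?_).symm
        refine measure_mono_null (t := {M + m}) ?_ (by simp)
        rintro _ ⟨⟨a, ha, rfl⟩, ⟨b, hb, hab⟩⟩
        have := hAM ha
        have := hBm hb
        simp only at hab ⊢
        rw [Set.mem_singleton_iff]
        linarith
    _ ≤ volume C := by
        refine measure_mono ?_
        rintro _ (⟨a, ha, rfl⟩ | ⟨b, hb, rfl⟩)
        exacts [h a ha m hm, h M hM b hb]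

/-- The one-dimensional Brunn–Minkowski inequality. -/
theorem volume_add_volume_le_of_add_subset {A B C : Set ℝ} (hA : MeasurableSet A)
    (hB : MeasurableSet B) (hA₀ : A.Nonempty) (hB₀ : B.Nonempty)
    (h : ∀ a ∈ A, ∀ b ∈ B, a + b ∈ C) : volume A + volume B ≤ volume C := by
  obtain ⟨a₀, ha₀⟩ := hA₀
  obtain ⟨b₀, hb₀⟩ := hB₀
  rw [hA.measure_eq_iSup_isCompact, hB.measure_eq_iSup_isCompact]
  simp only [iSup_and']
  refine ENNReal.biSup_add_biSup_le' (p := fun K => K ⊆ A ∧ IsCompact K)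
    (q := fun K => K ⊆ B ∧ IsCompact K) ⟨∅, by simp⟩ ⟨∅, by simp⟩ ?_
  rintro K ⟨hKA, hK⟩ L ⟨hLB, hL⟩
  refine le_trans (add_le_add (measure_mono (Set.subset_insert a₀ K))
    (measure_mono (Set.subset_insert b₀ L)))
    (volume_add_volume_le_of_isCompact (hK.insert a₀) (hL.insert b₀) (by simp) (by simp) ?_)
  intro a ha b hb
  exact h a (Set.insert_subset ha₀ hKA ha) b (Set.insert_subset hb₀ hLB hb)

theorem antitone_volume_lt {X : Type*} [MeasureSpace X] (α : X → ℝ) :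
    Antitone fun s => volume {x | s < α x} :=
  fun _ _ hst => measure_mono fun _ hx => hst.trans_lt hx

theorem lintegral_add_lintegral_le_of_lt_imp {α β γ : ℝ → ℝ} (hα : Measurable α)
    (hβ : Measurable β) (hγ : Measurable γ) (hα₀ : ∀ x, 0 ≤ α x) (hβ₀ : ∀ x, 0 ≤ β x)
    (hγ₀ : ∀ x, 0 ≤ γ x) (hα₁ : ∀ x, α x ≤ 1) (hβ₁ : ∀ x, β x ≤ 1)
    (hαs : ∀ s < 1, ∃ x, s < α x) (hβs : ∀ s < 1, ∃ x, s < β x)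
    (h : ∀ s, 0 ≤ s → ∀ x y, s < α x → s < β y → s < γ (x + y)) :
    (∫⁻ x, ENNReal.ofReal (α x)) + (∫⁻ x, ENNReal.ofReal (β x)) ≤
      ∫⁻ x, ENNReal.ofReal (γ x) := by
  rw [lintegral_eq_lintegral_meas_lt _ (.of_forall hα₀) hα.aemeasurable,
    lintegral_eq_lintegral_meas_lt _ (.of_forall hβ₀) hβ.aemeasurable,
    lintegral_eq_lintegral_meas_lt _ (.of_forall hγ₀) hγ.aemeasurable,
    ← lintegral_add_left (antitone_volume_lt α).measurable]
  refine setLIntegral_mono_ae' measurableSet_Ioi (.of_forall fun s hs => ?_)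
  rcases lt_or_ge s 1 with hs₁ | hs₁
  · exact volume_add_volume_le_of_add_subset (measurableSet_lt measurable_const hα)
      (measurableSet_lt measurable_const hβ) (hαs s hs₁) (hβs s hs₁)
      fun x hx y hy => h s (le_of_lt hs) x y hx hy
  · have h₁ : {x | s < α x} = ∅ := by
      ext x; simpa using (hα₁ x).trans hs₁
    have h₂ : {x | s < β x} = ∅ := by
      ext x; simpa using (hβ₁ x).trans hs₁
    simp [h₁, h₂]

theorem volume_slice_ne_top {A : Set (ℝ × ℝ)} {R : ℝ} (hR : ∀ p ∈ A, |p.2| ≤ R) (x : ℝ) :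
    volume (Prod.mk x ⁻¹' A) ≠ ⊤ := by
  refine ne_top_of_le_ne_top (isCompact_Icc (a := -R) (b := R)).measure_ne_top
    (measure_mono fun y hy => ?_)
  exact abs_le.1 (hR _ hy)

theorem bddAbove_slice {A : Set (ℝ × ℝ)} {R : ℝ} (hR : ∀ p ∈ A, |p.2| ≤ R) :
    BddAbove (Set.range fun x => volume.real (Prod.mk x ⁻¹' A)) := by
  refine ⟨volume.real (Set.Icc (-R) R), ?_⟩
  rintro _ ⟨x, rfl⟩
  exact measureReal_mono (fun y hy => abs_le.1 (hR _ hy))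
    (isCompact_Icc (a := -R) (b := R)).measure_ne_top

theorem iSup_slice_pos {A : Set (ℝ × ℝ)} (hA : MeasurableSet A) {R : ℝ}
    (hR : ∀ p ∈ A, |p.2| ≤ R) (hA₀ : volume A ≠ 0) :
    0 < ⨆ x, volume.real (Prod.mk x ⁻¹' A) := by
  by_contra! hM
  refine hA₀ ?_
  rw [Measure.volume_eq_prod, Measure.measure_prod_null hA]
  refine .of_forall fun x => ?_
  have := (le_ciSup (bddAbove_slice hR) x).trans hM
  exact (measureReal_eq_zero_iff (volume_slice_ne_top hR x)).1
    (le_antisymm this measureReal_nonneg)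

theorem lintegral_slice_div {A : Set (ℝ × ℝ)} (hA : MeasurableSet A) {R : ℝ}
    (hR : ∀ p ∈ A, |p.2| ≤ R) {M : ℝ} (hM : 0 < M) :
    ∫⁻ x, ENNReal.ofReal (volume.real (Prod.mk x ⁻¹' A) / M) =
      volume A / ENNReal.ofReal M := by
  rw [Measure.volume_eq_prod, Measure.prod_apply hA]
  simp_rw [ENNReal.ofReal_div_of_pos hM, div_eq_mul_inv]
  rw [lintegral_mul_const' _ _ (by simpa using hM)]
  congr 2 with x
  exact ENNReal.ofReal_toReal (volume_slice_ne_top hR x)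

/-- The Brunn–Minkowski inequality in the plane. -/
theorem add_volume_add_two_mul_sqrt_le {A B C : Set (ℝ × ℝ)} (hA : MeasurableSet A)
    (hB : MeasurableSet B) (hC : MeasurableSet C) {R : ℝ} (hAR : ∀ p ∈ A, |p.2| ≤ R)
    (hBR : ∀ p ∈ B, |p.2| ≤ R) (hCR : ∀ p ∈ C, |p.2| ≤ R) (hA₀ : volume A ≠ 0)
    (hB₀ : volume B ≠ 0) (hC₀ : volume C ≠ ⊤)
    (h : ∀ a ∈ A, ∀ b ∈ B, a + b ∈ C) :
    volume.real A + volume.real B + 2 * √(volume.real A * volume.real B) ≤ volume.real C := by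
  set a : ℝ → ℝ := fun x => volume.real (Prod.mk x ⁻¹' A) with ha
  set b : ℝ → ℝ := fun x => volume.real (Prod.mk x ⁻¹' B) with hb
  set c : ℝ → ℝ := fun x => volume.real (Prod.mk x ⁻¹' C) with hc
  have hM := iSup_slice_pos hA hAR hA₀
  have hN := iSup_slice_pos hB hBR hB₀
  set M := ⨆ x, volume.real (Prod.mk x ⁻¹' A) with hM'
  set N := ⨆ x, volume.real (Prod.mk x ⁻¹' B) with hN'
  have key := lintegral_add_lintegral_le_of_lt_imp (α := fun x => a x / M) (β := fun x => b x / N)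
    (γ := fun x => c x / (M + N))
    ((measurable_measure_prodMk_left hA).ennreal_toReal.div_const _)
    ((measurable_measure_prodMk_left hB).ennreal_toReal.div_const _)
    ((measurable_measure_prodMk_left hC).ennreal_toReal.div_const _)
    (fun x => by positivity) (fun x => by positivity) (fun x => by positivity)
    (fun x => (div_le_one hM).2 (le_ciSup (bddAbove_slice hAR) x))
    (fun x => (div_le_one hN).2 (le_ciSup (bddAbove_slice hBR) x))
    (fun s hs => by
      obtain ⟨x, hx⟩ := exists_lt_of_lt_ciSup (show s * M < M by nlinarith)
      exact ⟨x, (lt_div_iff₀ hM).2 hx⟩)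
    (fun s hs => by
      obtain ⟨x, hx⟩ := exists_lt_of_lt_ciSup (show s * N < N by nlinarith)
      exact ⟨x, (lt_div_iff₀ hN).2 hx⟩)
    (fun s hs x y hx hy => by
      rw [lt_div_iff₀ hM] at hx
      rw [lt_div_iff₀ hN] at hy
      rw [lt_div_iff₀ (by positivity)]
      have hxA : (Prod.mk x ⁻¹' A).Nonempty := by
        refine nonempty_of_measure_ne_zero (μ := volume) fun h0 => ?_
        have : a x = 0 := by simp [ha, measureReal_def, h0]
        nlinarith
      have hyB : (Prod.mk y ⁻¹' B).Nonempty := by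
        refine nonempty_of_measure_ne_zero (μ := volume) fun h0 => ?_
        have : b y = 0 := by simp [hb, measureReal_def, h0]
        nlinarith
      have h1 := volume_add_volume_le_of_add_subset (measurable_prodMk_left hA)
        (measurable_prodMk_left hB) hxA hyB (C := Prod.mk (x + y) ⁻¹' C)
        (fun u hu v hv => h _ hu _ hv)
      have h2 : a x + b y ≤ c (x + y) := by
        simp only [ha, hb, hc, measureReal_def]
        rw [← ENNReal.toReal_add (volume_slice_ne_top hAR x) (volume_slice_ne_top hBR y)]
        exact ENNReal.toReal_mono (volume_slice_ne_top hCR _) h1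
      linarith)
  simp only [ha, hb, hc] at key
  have hMN : 0 < M + N := by positivity
  rw [lintegral_slice_div hA hAR hM, lintegral_slice_div hB hBR hN,
    lintegral_slice_div hC hCR hMN] at key
  have hfin : volume C / ENNReal.ofReal (M + N) ≠ ⊤ :=
    ENNReal.div_ne_top hC₀ (by simpa using hMN)
  have key' := ENNReal.toReal_mono hfin key
  rw [ENNReal.toReal_add (ne_top_of_le_ne_top hfin (le_self_add.trans key))
    (ne_top_of_le_ne_top hfin (le_add_self.trans key))] at key'
  simp only [ENNReal.toReal_div, ENNReal.toReal_ofReal hM.le, ENNReal.toReal_ofReal hN.le,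
    ENNReal.toReal_ofReal hMN.le, ← measureReal_def] at key'
  rw [le_div_iff₀ hMN] at key'
  set X := volume.real A
  set Y := volume.real B
  have hX : 0 ≤ X := measureReal_nonneg
  have hY : 0 ≤ Y := measureReal_nonneg
  have e₁ : X * Y = (N * X / M) * (M * Y / N) := by field_simp
  have e₂ : (X / M + Y / N) * (M + N) = X + Y + (N * X / M + M * Y / N) := by field_simp; ring
  have e₃ : 2 * √(X * Y) ≤ N * X / M + M * Y / N := by
    have hp : 0 ≤ N * X / M := by positivity
    have hq : 0 ≤ M * Y / N := by positivity
    rw [e₁, Real.sqrt_mul hp]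
    nlinarith [sq_nonneg (√(N * X / M) - √(M * Y / N)), Real.sq_sqrt hp, Real.sq_sqrt hq]
  linarith

/-- The Brunn–Minkowski inequality for the sum of a bounded open set and a disc. -/
theorem volume_add_two_mul_sqrt_pi_le_thickening {A : Set ℂ} (hA : IsOpen A)
    (hAb : Bornology.IsBounded A) {ε : ℝ} (hε : 0 < ε) :
    volume.real A + 2 * √(Real.pi * volume.real A) * ε ≤
      volume.real (Metric.thickening ε A) := by
  rcases A.eq_empty_or_nonempty with rfl | hne
  · simp
  have hTb : Bornology.IsBounded (Metric.thickening ε A) := hAb.thickening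
  obtain ⟨R, hR⟩ := (hTb.union (Metric.isBounded_ball (x := (0 : ℂ)) (r := ε))).exists_norm_le
  have hmp := Complex.volume_preserving_equiv_real_prod.symm
  have hvol : ∀ S : Set ℂ,
      volume (Complex.measurableEquivRealProd.symm ⁻¹' S) = volume S :=
    fun S => hmp.measure_preimage_equiv S
  have him : ∀ S ⊆ Metric.thickening ε A ∪ Metric.ball 0 ε,
      ∀ p ∈ Complex.measurableEquivRealProd.symm ⁻¹' S, |p.2| ≤ R := by
    intro S hS p hp
    exact (Complex.abs_im_le_norm (Complex.measurableEquivRealProd.symm p)).trans (hR _ (hS hp))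
  have key := add_volume_add_two_mul_sqrt_le
    (A := Complex.measurableEquivRealProd.symm ⁻¹' A)
    (B := Complex.measurableEquivRealProd.symm ⁻¹' (Metric.ball 0 ε))
    (C := Complex.measurableEquivRealProd.symm ⁻¹' (Metric.thickening ε A))
    (Complex.measurableEquivRealProd.symm.measurable hA.measurableSet)
    (Complex.measurableEquivRealProd.symm.measurable Metric.isOpen_ball.measurableSet)
    (Complex.measurableEquivRealProd.symm.measurable Metric.isOpen_thickening.measurableSet)
    (him _ ((Metric.self_subset_thickening hε A).trans Set.subset_union_left))
    (him _ Set.subset_union_right) (him _ Set.subset_union_left)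
    (by rw [hvol]; exact (hA.measure_pos _ hne).ne')
    (by rw [hvol]; exact (Metric.measure_ball_pos _ _ hε).ne')
    (by rw [hvol]; exact hTb.measure_lt_top.ne)
    (by
      intro a ha b hb
      refine Metric.mem_thickening_iff.2 ⟨_, ha, ?_⟩
      have : Complex.measurableEquivRealProd.symm (a + b) =
        Complex.measurableEquivRealProd.symm a + Complex.measurableEquivRealProd.symm b := rfl
      rw [this, dist_eq_norm, add_sub_cancel_left]
      simpa using hb)
  simp only [measureReal_def, hvol] at key ⊢
  have hball : (volume (Metric.ball (0 : ℂ) ε)).toReal = Real.pi * ε ^ 2 := by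
    simp [Complex.volume_ball, hε.le, mul_comm]
  rw [hball, show (volume A).toReal * (Real.pi * ε ^ 2) = Real.pi * (volume A).toReal * ε ^ 2 by
    ring, Real.sqrt_mul (by positivity), Real.sqrt_sq hε.le] at key
  have : 0 ≤ Real.pi * ε ^ 2 := by positivity
  linarith

theorem exists_forall_le_add_mul_norm_fderiv {g : ℂ → ℝ} (hg : ContDiff ℝ 1 g)
    (hgc : HasCompactSupport g) {ω : ℝ} (hω : 0 < ω) :
    ∃ ε > 0, ε ≤ 1 ∧ ∀ x y, dist x y < ε → g y ≤ g x + ε * (‖fderiv ℝ g x‖ + ω) := by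
  have huc : UniformContinuous (fderiv ℝ g) :=
    (hg.continuous_fderiv one_ne_zero).uniformContinuous_of_tendsto_cocompact
      (hgc.fderiv (𝕜 := ℝ)).is_zero_at_infty
  obtain ⟨ε, hε, h⟩ := Metric.uniformContinuous_iff.1 huc ω hω
  refine ⟨min ε 1, by positivity, min_le_right _ _, fun x y hxy => ?_⟩
  have hb : ∀ z ∈ Metric.ball x (min ε 1), ‖fderiv ℝ g z‖ ≤ ‖fderiv ℝ g x‖ + ω := by
    intro z hz
    have h1 := h (lt_of_lt_of_le (Metric.mem_ball.1 hz) (min_le_left _ _))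
    rw [dist_eq_norm] at h1
    have := norm_le_norm_add_norm_sub' (fderiv ℝ g z) (fderiv ℝ g x)
    linarith
  have hx : x ∈ Metric.ball x (min ε 1) := Metric.mem_ball_self (by positivity)
  have hy : y ∈ Metric.ball x (min ε 1) := by rwa [Metric.mem_ball, dist_comm]
  have h2 := (convex_ball x (min ε 1)).norm_image_sub_le_of_norm_fderiv_le (𝕜 := ℝ)
    (fun z _ => hg.differentiable one_ne_zero z) hb hx hy
  have h3 : ‖y - x‖ ≤ min ε 1 := by rw [← dist_eq_norm, dist_comm]; exact hxy.le
  have h4 := (le_abs_self _).trans h2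
  nlinarith [norm_nonneg (fderiv ℝ g x)]

theorem ofReal_integral_eq_lintegral_volume_lt {h : ℂ → ℝ} (hi : Integrable h) (h₀ : ∀ x, 0 ≤ h x) :
    ENNReal.ofReal (∫ x, h x) = ∫⁻ s in Set.Ioi (0 : ℝ), volume {x | s < h x} := by
  rw [ofReal_integral_eq_lintegral_ofReal hi (.of_forall h₀),
    lintegral_eq_lintegral_meas_lt _ (.of_forall h₀) hi.aemeasurable]

/-- A functional form of the isoperimetric inequality in the plane. -/
theorem two_mul_sqrt_mul_le_integral_norm_fderiv {g : ℂ → ℝ} (hg : ContDiff ℝ 1 g)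
    (hgc : HasCompactSupport g) (hg₀ : ∀ x, 0 ≤ g x) {c : ℝ} (hc : 0 < c)
    {A : Set ℂ} (hA : ∀ x ∈ A, c ≤ g x) :
    2 * √(Real.pi * volume.real A) * c ≤ ∫ x, ‖fderiv ℝ g x‖ := by
  set D := 2 * √(Real.pi * volume.real A) with hD
  have hD₀ : 0 ≤ D := by positivity
  set K := Metric.cthickening 1 (tsupport g) with hK
  have hKc : IsCompact K := hgc.isCompact.cthickening
  have hgi : Integrable g := hg.continuous.integrable_of_hasCompactSupport hgc
  have hgi' : Integrable fun x => ‖fderiv ℝ g x‖ :=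
    ((hg.continuous_fderiv one_ne_zero).integrable_of_hasCompactSupport
      (hgc.fderiv (𝕜 := ℝ))).norm
  have hKi : Integrable (K.indicator fun _ => (1 : ℝ)) :=
    (integrable_indicator_iff hKc.measurableSet).2 (integrableOn_const hKc.measure_ne_top)
  have hlev : ∀ s : ℝ, 0 < s → {x | s < g x} ⊆ tsupport g := fun s hs x hx =>
    subset_tsupport _ (hs.trans hx).ne'
  have main : ∀ ω > 0, D * c ≤ (∫ x, ‖fderiv ℝ g x‖) + ω * volume.real K := by
    intro ω hω
    obtain ⟨ε, hε, hε₁, h⟩ := exists_forall_le_add_mul_norm_fderiv hg hgc hω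
    set G : ℂ → ℝ := fun x => g x + ε * (‖fderiv ℝ g x‖ + ω * K.indicator (fun _ => (1 : ℝ)) x)
      with hG
    have hind : ∀ x, 0 ≤ K.indicator (fun _ => (1 : ℝ)) x :=
      fun x => Set.indicator_nonneg (fun _ _ => zero_le_one) x
    have hG₀ : ∀ x, 0 ≤ G x := fun x => by
      have := hg₀ x
      have := hind x
      positivity
    have hGi : Integrable G := hgi.add ((hgi'.add (hKi.const_mul ω)).const_mul ε)
    have hsub : ∀ s, 0 < s → Metric.thickening ε {x | s < g x} ⊆ {x | s < G x} := by
      intro s hs y hy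
      obtain ⟨x, hx, hxy⟩ := Metric.mem_thickening_iff.1 hy
      have hyK : y ∈ K := Metric.mem_cthickening_of_dist_le y x _ _ (hlev s hs hx)
        (hxy.le.trans hε₁)
      have := h y x hxy
      simp only [Set.mem_ofPred_eq, hG, Set.indicator_of_mem hyK, mul_one] at hx ⊢
      linarith
    have hlevel : ∀ s ∈ Set.Ioi (0 : ℝ), volume {x | s < g x} +
        (Set.Ioo 0 c).indicator (fun _ => ENNReal.ofReal (D * ε)) s ≤ volume {x | s < G x} := by
      intro s hs
      have hfin : volume {x | s < g x} ≠ ⊤ :=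
        ne_top_of_le_ne_top hgc.isCompact.measure_ne_top (measure_mono (hlev s hs))
      have hGfin : volume {x | s < G x} ≠ ⊤ := by
        refine ne_top_of_le_ne_top (hGi.measure_ge_lt_top hs).ne (measure_mono ?_)
        exact fun x (hx : s < G x) => hx.le
      by_cases hsc : s ∈ Set.Ioo 0 c
      · rw [Set.indicator_of_mem hsc]
        have h1 := volume_add_two_mul_sqrt_pi_le_thickening (A := {x | s < g x})
          (isOpen_lt continuous_const hg.continuous)
          (hgc.isCompact.isBounded.subset (hlev s hs)) hε
        have h2 : volume.real (Metric.thickening ε {x | s < g x}) ≤ volume.real {x | s < G x} :=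
          measureReal_mono (hsub s hs) hGfin
        have h3 : volume.real A ≤ volume.real {x | s < g x} :=
          measureReal_mono (fun x hx => hsc.2.trans_le (hA x hx)) hfin
        have h4 : D ≤ 2 * √(Real.pi * volume.real {x | s < g x}) := by
          rw [hD]; gcongr
        rw [← ofReal_measureReal hfin, ← ofReal_measureReal hGfin,
          ← ENNReal.ofReal_add measureReal_nonneg (by positivity)]
        refine ENNReal.ofReal_le_ofReal ?_
        nlinarith
      · rw [Set.indicator_of_notMem hsc, add_zero]
        refine measure_mono fun x (hx : s < g x) => hx.trans_le ?_
        have := hind x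
        simp only [hG, le_add_iff_nonneg_right]
        positivity
    have hint : ENNReal.ofReal ((∫ x, g x) + D * ε * c) ≤ ENNReal.ofReal (∫ x, G x) := by
      rw [ENNReal.ofReal_add (integral_nonneg hg₀) (by positivity),
        ofReal_integral_eq_lintegral_volume_lt hgi hg₀,
        ofReal_integral_eq_lintegral_volume_lt hGi hG₀]
      refine le_trans (le_of_eq ?_) (setLIntegral_mono_ae' measurableSet_Ioi (.of_forall hlevel))
      rw [lintegral_add_left (antitone_volume_lt g).measurable,
        lintegral_indicator measurableSet_Ioo,
        Measure.restrict_restrict measurableSet_Ioo, lintegral_const, Measure.restrict_apply .univ]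
      have : Set.univ ∩ (Set.Ioo 0 c ∩ Set.Ioi 0) = Set.Ioo 0 c := by
        ext x; simp +contextual
      rw [this, Real.volume_Ioo, sub_zero, ← ENNReal.ofReal_mul (by positivity)]
    rw [ENNReal.ofReal_le_ofReal_iff (integral_nonneg hG₀)] at hint
    have hGint : ∫ x, G x = (∫ x, g x) + ε * ((∫ x, ‖fderiv ℝ g x‖) + ω * volume.real K) := by
      calc ∫ x, G x = (∫ x, g x) +
            ∫ x, ε * (‖fderiv ℝ g x‖ + ω * K.indicator (fun _ => (1 : ℝ)) x) :=
          integral_add hgi ((hgi'.add (hKi.const_mul ω)).const_mul ε)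
        _ = (∫ x, g x) + ε * ((∫ x, ‖fderiv ℝ g x‖) + ω * volume.real K) := by
          rw [integral_const_mul, integral_add hgi' (hKi.const_mul ω), integral_const_mul,
            integral_indicator_const _ hKc.measurableSet, smul_eq_mul, mul_one]
    rw [hGint] at hint
    have : ε * (D * c) ≤ ε * ((∫ x, ‖fderiv ℝ g x‖) + ω * volume.real K) := by linarith
    exact le_of_mul_le_mul_left this hε
  refine le_of_forall_pos_le_add fun η hη => ?_
  refine (main (η / (volume.real K + 1)) (by positivity)).trans ?_
  gcongr
  rw [div_mul_eq_mul_div, div_le_iff₀ (by positivity)]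
  nlinarith

theorem two_pi_mul_enorm_le_lintegral {H : ℂ → ℂ} (hH : Differentiable ℂ H) (z : ℂ) :
    ENNReal.ofReal (2 * Real.pi) * ‖H 0‖ₑ ≤
      ∫⁻ θ in Set.Ioc 0 (2 * Real.pi), ‖H (circleMap 0 1 θ * z)‖ₑ := by
  have h1 : Real.circleAverage (fun w => H (w * z)) 0 1 = H 0 := by
    have := DiffContOnCl.circleAverage (f := fun w => H (w * z)) (c := 0) (R := 1)
      (Differentiable.diffContOnCl (by fun_prop))
    simpa using this
  rw [Real.circleAverage_def, intervalIntegral.integral_of_le Real.two_pi_pos.le] at h1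
  have h2 : (2 * Real.pi) • H 0 = ∫ θ in Set.Ioc 0 (2 * Real.pi), H (circleMap 0 1 θ * z) := by
    rw [← h1, smul_inv_smul₀ Real.two_pi_pos.ne']
  calc ENNReal.ofReal (2 * Real.pi) * ‖H 0‖ₑ = ‖(2 * Real.pi) • H 0‖ₑ := by
        rw [enorm_smul, Real.enorm_eq_ofReal Real.two_pi_pos.le]
    _ ≤ _ := by rw [h2]; exact enorm_integral_le_lintegral_enorm _

theorem lintegral_ball_enorm_comp_circleMap_mul (H : ℂ → ℂ) (θ : ℝ) :
    ∫⁻ z in Metric.ball 0 1, ‖H (circleMap 0 1 θ * z)‖ₑ = ∫⁻ z in Metric.ball 0 1, ‖H z‖ₑ := by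
  have hmp := (rotation (Circle.exp θ)).measurePreserving
  have h := hmp.setLIntegral_comp_preimage_emb
    (rotation (Circle.exp θ)).toHomeomorph.measurableEmbedding
    (fun z => ‖H z‖ₑ) (Metric.ball 0 1)
  rw [← h]
  have : (rotation (Circle.exp θ)) ⁻¹' (Metric.ball 0 1) = Metric.ball 0 1 := by
    rw [LinearIsometryEquiv.preimage_ball, map_zero]
  rw [this]
  simp [rotation_apply, circleMap]

/-- The sub-mean value inequality on the unit disc for the modulus of an entire function. -/
theorem enorm_mul_volume_ball_le_lintegral {H : ℂ → ℂ} (hH : Differentiable ℂ H) :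
    ‖H 0‖ₑ * volume (Metric.ball (0 : ℂ) 1) ≤ ∫⁻ z in Metric.ball 0 1, ‖H z‖ₑ := by
  have hpos : ENNReal.ofReal (2 * Real.pi) ≠ 0 := by simp [Real.pi_pos]
  rw [← ENNReal.mul_le_mul_iff_right hpos ENNReal.ofReal_ne_top]
  have hHc := hH.continuous
  calc ENNReal.ofReal (2 * Real.pi) * (‖H 0‖ₑ * volume (Metric.ball (0 : ℂ) 1))
      = ∫⁻ _ in Metric.ball (0 : ℂ) 1, ENNReal.ofReal (2 * Real.pi) * ‖H 0‖ₑ := by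
        rw [setLIntegral_const, mul_assoc]
    _ ≤ ∫⁻ z in Metric.ball (0 : ℂ) 1, ∫⁻ θ in Set.Ioc 0 (2 * Real.pi),
          ‖H (circleMap 0 1 θ * z)‖ₑ :=
        lintegral_mono fun z => two_pi_mul_enorm_le_lintegral hH z
    _ = ∫⁻ θ in Set.Ioc 0 (2 * Real.pi), ∫⁻ z in Metric.ball (0 : ℂ) 1,
          ‖H (circleMap 0 1 θ * z)‖ₑ := by
        refine lintegral_lintegral_swap (Measurable.aemeasurable ?_)
        exact Continuous.measurable (by unfold Function.uncurry; fun_prop)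
    _ = ENNReal.ofReal (2 * Real.pi) * ∫⁻ z in Metric.ball 0 1, ‖H z‖ₑ := by
        simp_rw [lintegral_ball_enorm_comp_circleMap_mul]
        rw [setLIntegral_const, Real.volume_Ioc, sub_zero, mul_comm]

theorem pi_mul_norm_le_integral_ball {H : ℂ → ℂ} (hH : Differentiable ℂ H) :
    Real.pi * ‖H 0‖ ≤ ∫ z in Metric.ball 0 1, ‖H z‖ := by
  have h := enorm_mul_volume_ball_le_lintegral hH
  have hi : IntegrableOn (fun z => ‖H z‖) (Metric.ball 0 1) :=
    hH.continuous.norm.continuousOn.integrableOn_compact (isCompact_closedBall 0 1) |>.mono_set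
      Metric.ball_subset_closedBall
  rw [← ENNReal.ofReal_le_ofReal_iff (integral_nonneg fun _ => norm_nonneg _),
    ofReal_integral_eq_lintegral_ofReal hi (.of_forall fun _ => norm_nonneg _)]
  simp only [ofReal_norm]
  refine le_trans (le_of_eq ?_) h
  rw [ENNReal.ofReal_mul Real.pi_pos.le, ofReal_norm, Complex.volume_ball, mul_comm]
  simp [ENNReal.ofReal, NNReal.pi, Real.toNNReal_of_nonneg Real.pi_pos.le]
  rfl

/-- The square of `uFock f`. -/
noncomputable def sqFock (f : ℂ → ℂ) (z : ℂ) : ℝ := ‖f z‖ ^ 2 * Real.exp (-Real.pi * ‖z‖ ^ 2)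

theorem uFock_sq (f : ℂ → ℂ) (z : ℂ) : uFock f z ^ 2 = sqFock f z := by
  rw [uFock, sqFock, mul_pow, ← Real.exp_nat_mul]
  congr 2
  push_cast
  ring

theorem uFock_nonneg (f : ℂ → ℂ) (z : ℂ) : 0 ≤ uFock f z := by
  unfold uFock; positivity

theorem sqFock_nonneg (f : ℂ → ℂ) (z : ℂ) : 0 ≤ sqFock f z := by
  unfold sqFock; positivity

theorem continuous_sqFock {f : ℂ → ℂ} (hf : Continuous f) : Continuous (sqFock f) := by
  unfold sqFock; fun_prop

theorem sqFock_le_integral_ball {f : ℂ → ℂ} (hf : Differentiable ℂ f) (z : ℂ) :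
    Real.pi * sqFock f z ≤ Real.exp Real.pi * ∫ w in Metric.ball z 1, sqFock f w := by
  have hfc := hf.continuous
  have h := pi_mul_norm_le_integral_ball
    (H := fun w => (f (z + w) * Complex.exp (-Real.pi * (starRingEnd ℂ) z * w)) ^ 2) (by fun_prop)
  have hnorm : ∀ w, ‖(f (z + w) * Complex.exp (-Real.pi * (starRingEnd ℂ) z * w)) ^ 2‖ =
      sqFock f (z + w) * Real.exp (Real.pi * ‖z‖ ^ 2) * Real.exp (Real.pi * ‖w‖ ^ 2) := by
    intro w
    rw [norm_pow, norm_mul, Complex.norm_exp, mul_pow, ← Real.exp_nat_mul, sqFock, mul_assoc,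
      mul_assoc, ← Real.exp_add, mul_assoc, ← Real.exp_add]
    congr 2
    simp only [Complex.sq_norm, Complex.normSq_apply]
    simp
    ring
  simp only [hnorm] at h
  have hball : ∫ w in Metric.ball z 1, sqFock f w = ∫ w in Metric.ball 0 1, sqFock f (z + w) := by
    have := (measurePreserving_add_left volume z).setIntegral_preimage_emb
      (MeasurableEquiv.addLeft z).measurableEmbedding (sqFock f) (Metric.ball z 1)
    rw [← this]
    congr 2
    ext w; simp
  have hle : ∫ w in Metric.ball 0 1,
      sqFock f (z + w) * Real.exp (Real.pi * ‖z‖ ^ 2) * Real.exp (Real.pi * ‖w‖ ^ 2) ≤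
      ∫ w in Metric.ball 0 1,
        (Real.exp (Real.pi * ‖z‖ ^ 2) * Real.exp Real.pi) * sqFock f (z + w) := by
    have hS := continuous_sqFock hfc
    refine setIntegral_mono_on ?_ ?_ Metric.isOpen_ball.measurableSet fun w hw => ?_
    · exact ((Continuous.continuousOn (by fun_prop)).integrableOn_compact
        (isCompact_closedBall 0 1)).mono_set Metric.ball_subset_closedBall
    · exact ((Continuous.continuousOn (by fun_prop)).integrableOn_compact
        (isCompact_closedBall 0 1)).mono_set Metric.ball_subset_closedBall
    · have hw1 : ‖w‖ < 1 := by simpa using hw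
      have : Real.exp (Real.pi * ‖w‖ ^ 2) ≤ Real.exp Real.pi := by
        refine Real.exp_le_exp.2 (mul_le_of_le_one_right Real.pi_pos.le ?_)
        exact pow_le_one₀ (norm_nonneg _) hw1.le
      have h0 := sqFock_nonneg f (z + w)
      calc _ ≤ sqFock f (z + w) * Real.exp (Real.pi * ‖z‖ ^ 2) * Real.exp Real.pi := by gcongr
        _ = _ := by ring
  have h' := h.trans hle
  rw [integral_const_mul, ← hball] at h'
  simp only [add_zero, norm_zero] at h'
  have hE := Real.exp_pos (Real.pi * ‖z‖ ^ 2)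
  refine le_of_mul_le_mul_left (le_trans (le_of_eq ?_) (h'.trans (le_of_eq ?_))) hE
  · simp; ring
  · ring

theorem isBounded_setOf_le_sqFock {f : ℂ → ℂ} (hf : Differentiable ℂ f)
    (hint : Integrable (sqFock f)) {κ : ℝ} (hκ : 0 < κ) :
    Bornology.IsBounded {z | κ ≤ sqFock f z} := by
  have htend : Filter.Tendsto
      (fun n : ℕ => ∫ w in (Metric.closedBall (0 : ℂ) n)ᶜ, sqFock f w) Filter.atTop
      (nhds (∫ w in ⋂ n : ℕ, (Metric.closedBall (0 : ℂ) n)ᶜ, sqFock f w)) := by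
    refine tendsto_setIntegral_of_antitone (fun n => Metric.isClosed_closedBall.measurableSet.compl)
      (fun m n hmn => ?_) ⟨0, hint.integrableOn⟩
    exact Set.compl_subset_compl.2 (Metric.closedBall_subset_closedBall (by exact_mod_cast hmn))
  have hempty : ⋂ n : ℕ, (Metric.closedBall (0 : ℂ) n)ᶜ = ∅ := by
    rw [← Set.compl_iUnion, Metric.iUnion_closedBall_nat, Set.compl_univ]
  rw [hempty, setIntegral_empty] at htend
  have hpos : 0 < Real.pi * κ / Real.exp Real.pi := by positivity
  obtain ⟨n, hn⟩ := (htend.eventually_lt_const hpos).exists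
  refine (Metric.isBounded_closedBall (x := (0 : ℂ)) (r := n + 1)).subset fun z hz => ?_
  by_contra hzn
  have hsub : Metric.ball z 1 ⊆ (Metric.closedBall (0 : ℂ) n)ᶜ := by
    intro w hw hw'
    simp only [Metric.mem_closedBall, dist_zero_right, Metric.mem_ball] at *
    rw [dist_eq_norm] at hw
    have := norm_le_norm_add_norm_sub w z
    linarith
  have h1 := sqFock_le_integral_ball hf z
  have h2 : ∫ w in Metric.ball z 1, sqFock f w ≤
      ∫ w in (Metric.closedBall (0 : ℂ) n)ᶜ, sqFock f w :=
    setIntegral_mono_set hint.integrableOn (.of_forall fun w => sqFock_nonneg f w)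
      (Filter.Eventually.of_forall hsub)
  rw [lt_div_iff₀ (Real.exp_pos _)] at hn
  have h3 : Real.pi * κ ≤ Real.pi * sqFock f z := by
    have := Real.pi_pos
    gcongr
    exact hz
  nlinarith [Real.exp_pos Real.pi]

/-- Twice the Wirtinger derivative of `log (uFock f)`, away from the zeros of `f`. -/
noncomputable def logDerivFock (f : ℂ → ℂ) (z : ℂ) : ℂ :=
  deriv f z / f z - Real.pi * (starRingEnd ℂ) z

theorem contDiff_sqFock {f : ℂ → ℂ} (hf : Differentiable ℂ f) : ContDiff ℝ 1 (sqFock f) := by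
  have h : ContDiff ℝ 1 f := hf.contDiff.restrict_scalars ℝ
  unfold sqFock
  exact (h.norm_sq ℂ).mul (Real.contDiff_exp.comp (contDiff_const.mul (contDiff_norm_sq ℂ)))

theorem fderiv_sqFock_apply {f : ℂ → ℂ} (hf : Differentiable ℂ f) {z : ℂ} (hz : f z ≠ 0) (e : ℂ) :
    fderiv ℝ (sqFock f) z e = 2 * sqFock f z * (logDerivFock f z * e).re := by
  have h1 := ((hf z).hasDerivAt.complexToReal_fderiv).norm_sq
  have h2 := (((hasFDerivAt_id (𝕜 := ℝ) z).norm_sq).const_mul (-Real.pi)).exp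
  have h3 := (h1.mul h2).fderiv
  have h4 : fderiv ℝ (sqFock f) z = _ := h3
  rw [h4]
  have hn : ‖f z‖ ^ 2 ≠ 0 := by positivity
  have e1 : ((starRingEnd ℂ) (f z) * deriv f z) = (‖f z‖ ^ 2 : ℝ) * (deriv f z / f z) := by
    rw [← Complex.normSq_eq_norm_sq, ← Complex.mul_conj]
    field_simp
  have e2 : (f z).re * (deriv f z * e).re + (f z).im * (deriv f z * e).im =
      ‖f z‖ ^ 2 * (deriv f z / f z * e).re := by
    rw [← Complex.re_ofReal_mul (‖f z‖ ^ 2) (deriv f z / f z * e), ← mul_assoc, ← e1]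
    simp; ring
  simp [Complex.inner, sqFock, logDerivFock, sub_mul] at e2 ⊢
  linear_combination (2 * Real.exp (-(Real.pi * ‖z‖ ^ 2))) * e2

theorem norm_fderiv_sqFock_le {f : ℂ → ℂ} (hf : Differentiable ℂ f) {z : ℂ} (hz : f z ≠ 0) :
    ‖fderiv ℝ (sqFock f) z‖ ≤ 2 * sqFock f z * ‖logDerivFock f z‖ := by
  have h0 := sqFock_nonneg f z
  refine ContinuousLinearMap.opNorm_le_bound _ (by positivity) fun e => ?_
  calc ‖fderiv ℝ (sqFock f) z e‖ = 2 * sqFock f z * |(logDerivFock f z * e).re| := by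
        rw [fderiv_sqFock_apply hf hz, Real.norm_eq_abs, abs_mul, abs_of_nonneg (by positivity)]
    _ ≤ 2 * sqFock f z * ‖logDerivFock f z * e‖ := by
        gcongr
        exact Complex.abs_re_le_norm _
    _ = 2 * sqFock f z * ‖logDerivFock f z‖ * ‖e‖ := by rw [norm_mul, mul_assoc (2 * _)]

theorem contDiffAt_logDerivFock {f : ℂ → ℂ} (hf : Differentiable ℂ f) {z : ℂ} (hz : f z ≠ 0) :
    ContDiffAt ℝ 1 (logDerivFock f) z := by
  have h : ContDiff ℂ 1 f := hf.contDiff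
  have h' : ContDiff ℂ 1 (deriv f) := hf.deriv.contDiff
  exact ((h'.contDiffAt.div h.contDiffAt hz).restrict_scalars ℝ).sub
    (contDiffAt_const.mul Complex.conjCLE.contDiff.contDiffAt)

theorem fderiv_logDerivFock_apply {f : ℂ → ℂ} (hf : Differentiable ℂ f) {z : ℂ} (hz : f z ≠ 0)
    (e : ℂ) : fderiv ℝ (logDerivFock f) z e =
      deriv (fun w => deriv f w / f w) z * e - Real.pi * (starRingEnd ℂ) e := by
  have h1 := ((hf.deriv z).div (hf z) hz).hasDerivAt.complexToReal_fderiv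
  have h2 := (Complex.conjCLE.hasFDerivAt (x := z)).const_mul (Real.pi : ℂ)
  have h3 : fderiv ℝ (logDerivFock f) z = _ := (h1.sub h2).fderiv
  rw [h3]
  simp only [sub_apply, smul_apply, one_apply_eq_self, smul_eq_mul]
  rfl

theorem integral_fderiv_apply_eq_zero {X : ℂ → ℂ} (hX : ContDiff ℝ 1 X)
    (hXc : HasCompactSupport X) (e : ℂ) : ∫ z, fderiv ℝ X z e = 0 := by
  have h1 : Integrable fun z => fderiv ℝ X z e :=
    ((hX.continuous_fderiv one_ne_zero).clm_apply continuous_const).integrable_of_hasCompactSupport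
      (hXc.fderiv_apply (𝕜 := ℝ) e)
  have h2 : Integrable X := hX.continuous.integrable_of_hasCompactSupport hXc
  have := integral_mul_fderiv_eq_neg_fderiv_mul_of_integrable (μ := volume)
    (f := fun _ : ℂ => (1 : ℂ)) (g := X) (v := e) (by simp) (by simpa using h1) (by simpa using h2)
    (fun _ _ => by fun_prop) (fun x _ => hX.differentiable one_ne_zero x)
  simpa using this

section Green

variable {f : ℂ → ℂ} {Φ : ℝ → ℝ} {a : ℝ}

theorem contDiff_comp_sqFock_mul_logDerivFock (hf : Differentiable ℂ f) (hΦ : ContDiff ℝ 1 Φ)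
    (ha : 0 < a) (hΦa : ∀ s ≤ a, Φ s = 0) :
    ContDiff ℝ 1 fun z => (Φ (sqFock f z) : ℂ) * logDerivFock f z := by
  rw [contDiff_iff_contDiffAt]
  intro z
  by_cases hz : f z = 0
  · have hev : (fun z => (Φ (sqFock f z) : ℂ) * logDerivFock f z) =ᶠ[nhds z] fun _ => 0 := by
      have : ∀ᶠ w in nhds z, sqFock f w < a :=
        (continuous_sqFock hf.continuous).continuousAt.eventually_lt_const (by simpa [sqFock, hz])
      filter_upwards [this] with w hw
      simp [hΦa _ hw.le]
    exact contDiffAt_const.congr_of_eventuallyEq hev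
  · exact (Complex.ofRealCLM.contDiff.comp (hΦ.comp (contDiff_sqFock hf))).contDiffAt.mul
      (contDiffAt_logDerivFock hf hz)

theorem fderiv_comp_sqFock_mul_logDerivFock (hf : Differentiable ℂ f) (hΦ : ContDiff ℝ 1 Φ)
    (ha : 0 < a) (hΦa : ∀ s ≤ a, Φ s = 0) (z : ℂ) :
    fderiv ℝ (fun z => (Φ (sqFock f z) : ℂ) * logDerivFock f z) z 1 +
      Complex.I * fderiv ℝ (fun z => (Φ (sqFock f z) : ℂ) * logDerivFock f z) z Complex.I =
      ((deriv Φ (sqFock f z) * (2 * sqFock f z * ‖logDerivFock f z‖ ^ 2) -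
        2 * Real.pi * Φ (sqFock f z) : ℝ) : ℂ) := by
  by_cases hz : f z = 0
  · have hS : sqFock f z = 0 := by simp [sqFock, hz]
    have hev : (fun z => (Φ (sqFock f z) : ℂ) * logDerivFock f z) =ᶠ[nhds z] fun _ => 0 := by
      have : ∀ᶠ w in nhds z, sqFock f w < a :=
        (continuous_sqFock hf.continuous).continuousAt.eventually_lt_const (by rwa [hS])
      filter_upwards [this] with w hw
      simp [hΦa _ hw.le]
    rw [hev.fderiv_eq, hS, hΦa 0 ha.le]
    simp
  · have h1 := ((contDiff_sqFock hf).differentiable one_ne_zero z).hasFDerivAt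
    have h2 := ((hΦ.differentiable one_ne_zero (sqFock f z)).hasDerivAt.comp_hasFDerivAt z h1)
    have h3 := (Complex.ofRealCLM.hasFDerivAt.comp z h2)
    have h4 := ((contDiffAt_logDerivFock hf hz).differentiableAt one_ne_zero).hasFDerivAt
    have h5 : fderiv ℝ (fun z => (Φ (sqFock f z) : ℂ) * logDerivFock f z) z = _ :=
      (h3.mul h4).fderiv
    rw [h5]
    have hq : ((‖logDerivFock f z‖ ^ 2 : ℝ) : ℂ) =
        logDerivFock f z * (starRingEnd ℂ) (logDerivFock f z) := by
      rw [Complex.mul_conj, Complex.normSq_eq_norm_sq]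
    have hc : (starRingEnd ℂ) (logDerivFock f z) =
        ((logDerivFock f z).re : ℂ) - (logDerivFock f z).im * Complex.I :=
      by apply Complex.ext <;> simp
    simp only [add_apply, smul_apply,
      ContinuousLinearMap.comp_apply, fderiv_sqFock_apply hf hz, fderiv_logDerivFock_apply hf hz,
      Complex.ofRealCLM_apply, smul_eq_mul, Function.comp_apply, Complex.ofReal_mul,
      Complex.ofReal_sub, hq, hc, Complex.conj_I, map_one, mul_one, Complex.mul_I_re,
      Complex.ofReal_neg, Complex.ofReal_ofNat]
    linear_combination (Φ (sqFock f z) * (deriv (fun w => deriv f w / f w) z + Real.pi)) *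
      Complex.I_sq

theorem hasCompactSupport_of_sqFock (hf : Differentiable ℂ f)
    (hint : Integrable (sqFock f)) (ha : 0 < a) {E : Type*} [Zero E] {X : ℂ → E}
    (hX : ∀ z, sqFock f z ≤ a → X z = 0) : HasCompactSupport X := by
  refine HasCompactSupport.of_support_subset_isCompact (K := {z | a ≤ sqFock f z})
    (Metric.isCompact_of_isClosed_isBounded
      (isClosed_le continuous_const (continuous_sqFock hf.continuous))
      (isBounded_setOf_le_sqFock hf hint ha)) fun z hz => ?_
  by_contra h
  exact hz (hX z (not_le.1 h).le)

/-- Green's identity for `Φ ∘ sqFock f`, using that `log (uFock f)` has Laplacian `-2π` away from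
the zeros of `f`. -/
theorem integral_deriv_comp_sqFock (hf : Differentiable ℂ f)
    (hint : Integrable (sqFock f)) (hΦ : ContDiff ℝ 1 Φ)
    (ha : 0 < a) (hΦa : ∀ s ≤ a, Φ s = 0) :
    Integrable (fun z => deriv Φ (sqFock f z) * (2 * sqFock f z * ‖logDerivFock f z‖ ^ 2)) ∧
    ∫ z, deriv Φ (sqFock f z) * (2 * sqFock f z * ‖logDerivFock f z‖ ^ 2) =
      2 * Real.pi * ∫ z, Φ (sqFock f z) := by
  set X : ℂ → ℂ := fun z => (Φ (sqFock f z) : ℂ) * logDerivFock f z with hXdef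
  have hX : ContDiff ℝ 1 X := contDiff_comp_sqFock_mul_logDerivFock hf hΦ ha hΦa
  have hXc : HasCompactSupport X :=
    hasCompactSupport_of_sqFock hf hint ha fun z hz => by simp [hXdef, hΦa _ hz]
  have hi : ∀ e : ℂ, Integrable fun z => fderiv ℝ X z e := fun e =>
    ((hX.continuous_fderiv one_ne_zero).clm_apply continuous_const).integrable_of_hasCompactSupport
      (hXc.fderiv_apply (𝕜 := ℝ) e)
  have hgi : Integrable fun z => Φ (sqFock f z) :=
    (hΦ.continuous.comp (continuous_sqFock hf.continuous)).integrable_of_hasCompactSupport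
      (hasCompactSupport_of_sqFock hf hint ha fun z hz => hΦa _ hz)
  have hD := fderiv_comp_sqFock_mul_logDerivFock hf hΦ ha hΦa
  have hDi : Integrable fun z => (deriv Φ (sqFock f z) *
      (2 * sqFock f z * ‖logDerivFock f z‖ ^ 2) - 2 * Real.pi * Φ (sqFock f z)) := by
    have := ((hi 1).add ((hi Complex.I).const_mul Complex.I)).re
    refine this.congr (.of_forall fun z => ?_)
    simp only [Pi.add_apply, hXdef, hD z]
    exact Complex.ofReal_re _
  have hD0 : ∫ z, (deriv Φ (sqFock f z) *
      (2 * sqFock f z * ‖logDerivFock f z‖ ^ 2) - 2 * Real.pi * Φ (sqFock f z)) = 0 := by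
    rw [← Complex.ofReal_eq_zero, ← integral_complex_ofReal]
    simp_rw [← hD]
    rw [integral_add (hi 1) ((hi Complex.I).const_mul Complex.I), integral_const_mul,
      integral_fderiv_apply_eq_zero hX hXc, integral_fderiv_apply_eq_zero hX hXc]
    simp
  have hi' : Integrable fun z =>
      deriv Φ (sqFock f z) * (2 * sqFock f z * ‖logDerivFock f z‖ ^ 2) := by
    refine (hDi.add (hgi.const_mul (2 * Real.pi))).congr (.of_forall fun z => ?_)
    simp
  refine ⟨hi', ?_⟩
  rw [integral_sub hi' (hgi.const_mul _), integral_const_mul] at hD0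
  linarith

end Green

theorem exists_contDiff_step {a b r : ℝ} (hr : 0 < r) (hrab : 2 * r < b - a) :
    ∃ (Φ : ℝ → ℝ) (c : ℝ), 2 * r ≤ c ∧ ContDiff ℝ 1 Φ ∧ (∀ s ≤ a, Φ s = 0) ∧
      (∀ s, b ≤ s → Φ s = c) ∧ (∀ s, 0 ≤ deriv Φ s) ∧ (∀ s, deriv Φ s ≤ 1) ∧
      ∀ s ∉ Set.Ioo a b, deriv Φ s = 0 := by
  let H : ContDiffBump ((a + b) / 2) := ⟨r, (b - a) / 2, hr, by linarith⟩
  have hHc : Continuous H := H.continuous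
  have hH0 : ∀ s ∉ Set.Ioo a b, H s = 0 := by
    intro s hs
    refine H.zero_of_le_dist (?_ : (b - a) / 2 ≤ _)
    rw [Real.dist_eq]
    by_contra! h
    rw [abs_lt] at h
    exact hs ⟨by linarith, by linarith⟩
  have hderiv : ∀ s, deriv (fun s => ∫ x in a..s, H x) s = H s :=
    fun s => hHc.deriv_integral _ a s
  have hmono : Monotone fun s => ∫ x in a..s, H x :=
    monotone_of_deriv_nonneg
      (fun s => (intervalIntegral.integral_hasDerivAt_right (hHc.intervalIntegrable _ _)
        (hHc.stronglyMeasurableAtFilter _ _) hHc.continuousAt).differentiableAt)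
      fun s => (hderiv s).symm ▸ H.nonneg
  refine ⟨fun s => ∫ x in a..s, H x, ∫ x in a..b, H x, ?_, ?_, ?_, ?_, ?_, ?_, ?_⟩
  · have h1 : ∫ x in ((a + b) / 2 - r)..((a + b) / 2 + r), H x = 2 * r := by
      rw [intervalIntegral.integral_congr (g := fun _ => (1 : ℝ))]
      · simp; ring
      · intro x hx
        rw [Set.uIcc_of_le (by linarith)] at hx
        refine H.one_of_mem_closedBall ?_
        rw [Real.closedBall_eq_Icc]
        exact hx
    have h2 := intervalIntegral.integral_interval_sub_left
      (hHc.intervalIntegrable (μ := volume) a ((a + b) / 2 + r))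
      (hHc.intervalIntegrable a ((a + b) / 2 - r))
    have h3 := hmono (show a ≤ (a + b) / 2 - r by linarith)
    have h4 := hmono (show (a + b) / 2 + r ≤ b by linarith)
    simp only [intervalIntegral.integral_same] at h3 h4
    linarith
  · rw [contDiff_one_iff_deriv]
    refine ⟨fun s => (intervalIntegral.integral_hasDerivAt_right (hHc.intervalIntegrable _ _)
        (hHc.stronglyMeasurableAtFilter _ _) hHc.continuousAt).differentiableAt, ?_⟩
    rw [funext hderiv]
    exact hHc
  · intro s hs
    refine intervalIntegral.integral_zero_ae (.of_forall fun x hx => hH0 x ?_)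
    rw [Set.uIoc_of_ge hs] at hx
    exact fun h => absurd hx.2 (not_le.2 h.1)
  · intro s hs
    have h1 : ∫ x in b..s, H x = 0 := by
      refine intervalIntegral.integral_zero_ae (.of_forall fun x hx => hH0 x ?_)
      rw [Set.uIoc_of_le hs] at hx
      exact fun h => absurd h.2 (not_lt.2 hx.1.le)
    have h2 := intervalIntegral.integral_add_adjacent_intervals
      (hHc.intervalIntegrable (μ := volume) a b) (hHc.intervalIntegrable b s)
    simp only
    linarith
  · exact fun s => (hderiv s).symm ▸ H.nonneg
  · exact fun s => (hderiv s).symm ▸ H.le_one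
  · exact fun s hs => (hderiv s).trans (hH0 s hs)

theorem volume_lt_sqFock_ne_top {f : ℂ → ℂ} (hf : Differentiable ℂ f)
    (hint : Integrable (sqFock f)) {a : ℝ} (ha : 0 < a) : volume {z | a < sqFock f z} ≠ ⊤ :=
  ((isBounded_setOf_le_sqFock hf hint ha).subset
    (fun _ (hz : a < sqFock f _) => hz.le)).measure_lt_top.ne

theorem volume_mul_step_le {f : ℂ → ℂ} (hf : Differentiable ℂ f)
    (hint : Integrable (sqFock f)) {a b : ℝ} (ha : 0 < a) (hab : a < b)
    (hb : volume {z | b < sqFock f z} ≠ 0) {Φ : ℝ → ℝ} {c : ℝ} (hc : 0 < c)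
    (hΦ : ContDiff ℝ 1 Φ) (hΦa : ∀ s ≤ a, Φ s = 0) (hΦb : ∀ s, b ≤ s → Φ s = c)
    (hΦ₀ : ∀ s, 0 ≤ deriv Φ s) (hΦ₁ : ∀ s, deriv Φ s ≤ 1)
    (hΦs : ∀ s ∉ Set.Ioo a b, deriv Φ s = 0) :
    volume.real {z | b < sqFock f z} * c ≤ b * (volume.real {z | a < sqFock f z} *
      (volume.real {z | a < sqFock f z} - volume.real {z | b < sqFock f z})) := by
  have hSc := continuous_sqFock hf.continuous
  have hma := volume_lt_sqFock_ne_top hf hint ha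
  have hsub : {z | b < sqFock f z} ⊆ {z | a < sqFock f z} := fun z (hz : b < _) => hab.trans hz
  have hmb : volume {z | b < sqFock f z} ≠ ⊤ := ne_top_of_le_ne_top hma (measure_mono hsub)
  have hmeas : ∀ t, MeasurableSet {z | t < sqFock f z} := fun t =>
    measurableSet_lt measurable_const hSc.measurable
  have hdiff : volume.real ({z | a < sqFock f z} \ {z | b < sqFock f z}) =
      volume.real {z | a < sqFock f z} - volume.real {z | b < sqFock f z} :=
    measureReal_sdiff hsub (hmeas b) hma
  have hmono : Monotone Φ := monotone_of_deriv_nonneg (hΦ.differentiable one_ne_zero) hΦ₀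
  have hΦnn : ∀ s, 0 ≤ Φ s := fun s => by
    rcases le_total s a with h | h
    · exact (hΦa s h).ge
    · exact (hΦa a le_rfl).symm.le.trans (hmono h)
  have hΦc : ∀ s, Φ s ≤ c := fun s => by
    rcases le_total s b with h | h
    · exact (hmono h).trans (hΦb b le_rfl).le
    · exact (hΦb s h).le
  have hb₀ : 0 < volume.real {z | b < sqFock f z} := ENNReal.toReal_pos hb hmb
  have ha₀ : 0 < volume.real {z | a < sqFock f z} := hb₀.trans_le (measureReal_mono hsub hma)
  set mb := volume.real {z | b < sqFock f z}
  set ma := volume.real {z | a < sqFock f z}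
  have hgC : ContDiff ℝ 1 fun z => Φ (sqFock f z) := hΦ.comp (contDiff_sqFock hf)
  have hgc : HasCompactSupport fun z => Φ (sqFock f z) :=
    hasCompactSupport_of_sqFock hf hint ha fun z hz => hΦa _ hz
  have hiso := two_mul_sqrt_mul_le_integral_norm_fderiv hgC hgc (fun z => hΦnn _) hc
    (A := {z | b < sqFock f z}) (fun z (hz : b < _) => (hΦb _ hz.le).ge)
  obtain ⟨hEi, hE⟩ := integral_deriv_comp_sqFock hf hint hΦ ha hΦa
  have hgint : ∫ z, Φ (sqFock f z) ≤ c * ma := by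
    calc ∫ z, Φ (sqFock f z) ≤ ∫ z, {z | a < sqFock f z}.indicator (fun _ => c) z := by
          refine integral_mono (hgC.continuous.integrable_of_hasCompactSupport hgc)
            ((integrable_indicator_iff (hmeas a)).2 (integrableOn_const hma)) fun z => ?_
          by_cases hz : a < sqFock f z
          · rw [Set.indicator_of_mem (show z ∈ {z | a < sqFock f z} from hz)]
            exact hΦc _
          · rw [Set.indicator_of_notMem (show z ∉ {z | a < sqFock f z} from hz)]
            exact (hΦa _ (not_lt.1 hz)).le
      _ = c * ma := by
          rw [integral_indicator_const _ (hmeas a), smul_eq_mul, mul_comm]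
  have hdi : Continuous (deriv Φ) := hΦ.continuous_deriv le_rfl
  have hds : ∀ z, sqFock f z ≤ a → deriv Φ (sqFock f z) * (2 * sqFock f z) = 0 := fun z hz => by
    rw [hΦs _ fun h => absurd h.1 (not_lt.2 hz), zero_mul]
  have hVi : Integrable fun z => deriv Φ (sqFock f z) * (2 * sqFock f z) :=
    Continuous.integrable_of_hasCompactSupport (by fun_prop)
      (hasCompactSupport_of_sqFock hf hint ha hds)
  have hV : ∫ z, deriv Φ (sqFock f z) * (2 * sqFock f z) ≤ 2 * b * (ma - mb) := by
    calc ∫ z, deriv Φ (sqFock f z) * (2 * sqFock f z)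
        ≤ ∫ z, ({z | a < sqFock f z} \ {z | b < sqFock f z}).indicator (fun _ => 2 * b) z := by
          refine integral_mono hVi ((integrable_indicator_iff ((hmeas a).diff (hmeas b))).2
            (integrableOn_const (measure_ne_top_of_subset Set.sdiff_subset hma))) fun z => ?_
          have h0 := sqFock_nonneg f z
          by_cases hz : sqFock f z ∈ Set.Ioo a b
          · rw [Set.indicator_of_mem (show z ∈ {z | a < sqFock f z} \ {z | b < sqFock f z} from
              ⟨hz.1, not_lt.2 hz.2.le⟩)]
            have := hz.2
            nlinarith [hΦ₁ (sqFock f z), hΦ₀ (sqFock f z)]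
          · simp only [hΦs _ hz, zero_mul]
            exact Set.indicator_nonneg (fun _ _ => by linarith) z
      _ = 2 * b * (ma - mb) := by
          rw [integral_indicator_const _ ((hmeas a).diff (hmeas b)), smul_eq_mul, hdiff, mul_comm]
  have hpt : ∀ l > 0, ∀ z, ‖fderiv ℝ (fun z => Φ (sqFock f z)) z‖ ≤
      l / 2 * (deriv Φ (sqFock f z) * (2 * sqFock f z * ‖logDerivFock f z‖ ^ 2)) +
        1 / (2 * l) * (deriv Φ (sqFock f z) * (2 * sqFock f z)) := by
    intro l hl z
    have h0 := sqFock_nonneg f z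
    have h1 := hΦ₀ (sqFock f z)
    have hfd : fderiv ℝ (fun z => Φ (sqFock f z)) z =
        deriv Φ (sqFock f z) • fderiv ℝ (sqFock f) z :=
      ((hΦ.differentiable one_ne_zero (sqFock f z)).hasDerivAt.comp_hasFDerivAt z
        ((contDiff_sqFock hf).differentiable one_ne_zero z).hasFDerivAt).fderiv
    rw [hfd, norm_smul, Real.norm_of_nonneg h1]
    by_cases hz : f z = 0
    · have hS : sqFock f z = 0 := by simp [sqFock, hz]
      rw [hS, hΦs 0 fun h => absurd h.1 (not_lt.2 ha.le)]
      simp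
    · have h2 := norm_fderiv_sqFock_le hf hz
      have h3 : ‖logDerivFock f z‖ ≤ l / 2 * ‖logDerivFock f z‖ ^ 2 + 1 / (2 * l) := by
        have : l / 2 * ‖logDerivFock f z‖ ^ 2 + 1 / (2 * l) - ‖logDerivFock f z‖ =
            (l * ‖logDerivFock f z‖ - 1) ^ 2 / (2 * l) := by
          field_simp; ring
        have : 0 ≤ (l * ‖logDerivFock f z‖ - 1) ^ 2 / (2 * l) := by positivity
        linarith
      calc deriv Φ (sqFock f z) * ‖fderiv ℝ (sqFock f) z‖
          ≤ deriv Φ (sqFock f z) * (2 * sqFock f z * ‖logDerivFock f z‖) := by gcongr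
        _ ≤ deriv Φ (sqFock f z) *
            (2 * sqFock f z * (l / 2 * ‖logDerivFock f z‖ ^ 2 + 1 / (2 * l))) := by gcongr
        _ = _ := by ring
  set T := 2 * √(Real.pi * mb) * c with hT
  have hπ := Real.pi_pos
  have hT₀ : 0 < T := by positivity
  have hTl : ∀ l > 0, T ≤ l / 2 * (2 * Real.pi * (c * ma)) +
      1 / (2 * l) * (2 * b * (ma - mb)) := by
    intro l hl
    refine hiso.trans ?_
    refine (integral_mono ((hgC.continuous_fderiv one_ne_zero).integrable_of_hasCompactSupport
      (hgc.fderiv (𝕜 := ℝ))).norm ((hEi.const_mul _).add (hVi.const_mul _)) (hpt l hl)).trans ?_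
    simp only [Pi.add_apply]
    rw [integral_add (hEi.const_mul _) (hVi.const_mul _), integral_const_mul, integral_const_mul,
      hE]
    gcongr
  have hE₀ : 0 < 2 * Real.pi * (c * ma) := by positivity
  have h1 := hTl (T / (2 * Real.pi * (c * ma))) (by positivity)
  have h2 : T ^ 2 ≤ 2 * Real.pi * (c * ma) * (2 * b * (ma - mb)) := by
    have e : T / (2 * Real.pi * (c * ma)) / 2 * (2 * Real.pi * (c * ma)) +
        1 / (2 * (T / (2 * Real.pi * (c * ma)))) * (2 * b * (ma - mb)) =
        T / 2 + 2 * Real.pi * (c * ma) * (2 * b * (ma - mb)) / (2 * T) := by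
      field_simp
    rw [e] at h1
    have h3 : T / 2 ≤ 2 * Real.pi * (c * ma) * (2 * b * (ma - mb)) / (2 * T) := by linarith
    rw [le_div_iff₀ (by positivity)] at h3
    linarith
  have h4 : T ^ 2 = 4 * Real.pi * c * (mb * c) := by
    rw [hT, mul_pow, mul_pow, Real.sq_sqrt (by positivity)]
    ring
  rw [h4] at h2
  have h5 : (4 * Real.pi * c) * (mb * c) ≤ (4 * Real.pi * c) * (b * (ma * (ma - mb))) := by
    linarith
  exact le_of_mul_le_mul_left h5 (by positivity)

theorem volume_mul_sub_le {f : ℂ → ℂ} (hf : Differentiable ℂ f)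
    (hint : Integrable (sqFock f)) {a b : ℝ} (ha : 0 < a) (hab : a < b)
    (hb : volume {z | b < sqFock f z} ≠ 0) :
    volume.real {z | b < sqFock f z} * (b - a) ≤ b * (volume.real {z | a < sqFock f z} *
      (volume.real {z | a < sqFock f z} - volume.real {z | b < sqFock f z})) := by
  have key : ∀ d ∈ Set.Ioo 0 (b - a), volume.real {z | b < sqFock f z} * d ≤
      b * (volume.real {z | a < sqFock f z} *
      (volume.real {z | a < sqFock f z} - volume.real {z | b < sqFock f z})) := by
    rintro d ⟨hd₀, hd⟩
    obtain ⟨Φ, c, hc, hΦ, h1, h2, h3, h4, h5⟩ :=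
      exists_contDiff_step (a := a) (b := b) (half_pos hd₀) (by linarith)
    refine le_trans ?_ (volume_mul_step_le hf hint ha hab hb (by linarith) hΦ h1 h2 h3 h4 h5)
    gcongr
    linarith
  have hlim : Filter.Tendsto (fun d => volume.real {z | b < sqFock f z} * d)
      (nhdsWithin (b - a) (Set.Iio (b - a))) (nhds (volume.real {z | b < sqFock f z} * (b - a))) :=
    ((continuous_const.mul continuous_id).tendsto _).mono_left nhdsWithin_le_nhds
  refine le_of_tendsto hlim ?_
  filter_upwards [Ioo_mem_nhdsLT (sub_pos.2 hab)] with d hd using key d hd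

/-- A nonnegative nonincreasing function that loses at least `2δ`, up to lower order terms, on
each interval of length `δ` decreases at rate at least `2`. -/
theorem two_mul_sub_le_of_forall_mul_le {m : ℝ → ℝ} {α β : ℝ} (hαβ : α ≤ β) (hβ : 0 < m β)
    (hm : AntitoneOn m (Set.Icc α β))
    (h : ∀ s t, α ≤ s → s < t → t ≤ β →
      m t * (1 - Real.exp (-(2 * (t - s)))) ≤ m s * (m s - m t)) :
    2 * (β - α) ≤ m α - m β := by
  have main : ∀ ε ∈ Set.Ioo (0 : ℝ) 1, (1 - ε) ^ 2 * (2 * (β - α)) ≤ m α - m β := by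
    rintro ε ⟨hε₀, hε₁⟩
    obtain ⟨n, hn⟩ := exists_nat_gt (2 * (β - α) / (ε * min 1 (m β)))
    have hmin : 0 < ε * min 1 (m β) := by positivity
    have hn₀ : (0 : ℝ) < n := lt_of_le_of_lt (div_nonneg (by linarith) hmin.le) hn
    rw [div_lt_iff₀ hmin] at hn
    set δ := (β - α) / n with hδ
    have hδn : n * δ = β - α := by rw [hδ]; field_simp
    have hδ₀ : 0 ≤ δ := div_nonneg (by linarith) hn₀.le
    have hδε : 2 * δ ≤ ε * min 1 (m β) := by
      have : n * (2 * δ) ≤ n * (ε * min 1 (m β)) := by linarith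
      exact le_of_mul_le_mul_left this hn₀
    have hδε₁ : 2 * δ ≤ ε := hδε.trans (mul_le_of_le_one_right hε₀.le (min_le_left _ _))
    have hδε₂ : 2 * δ ≤ ε * m β := hδε.trans (by gcongr; exact min_le_right _ _)
    have step : ∀ s t, α ≤ s → t = s + δ → t ≤ β → (1 - ε) ^ 2 * (2 * δ) ≤ m s - m t := by
      intro s t hs hst ht
      rcases hδ₀.eq_or_lt with h0 | hδpos
      · simp [hst, ← h0]
      have hst' : s < t := by linarith
      have hms : m t ≤ m s := hm ⟨hs, by linarith⟩ ⟨by linarith, ht⟩ hst'.le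
      have hmt : m β ≤ m t := hm ⟨by linarith, ht⟩ ⟨hαβ, le_rfl⟩ ht
      have hs0 : 0 < m s := by linarith
      by_cases hc : (1 - ε) * m s ≤ m t
      · have h1 := h s t hs hst' ht
        have h2 : (1 - ε) * (2 * δ) ≤ 1 - Real.exp (-(2 * (t - s))) := by
          have e : t - s = δ := by linarith
          rw [e, Real.exp_neg]
          have h3 := Real.add_one_le_exp (2 * δ)
          have h4 : (Real.exp (2 * δ))⁻¹ ≤ (2 * δ + 1)⁻¹ := by gcongr
          have h5 : (2 * δ + 1)⁻¹ ≤ 1 - (1 - ε) * (2 * δ) := by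
            rw [inv_le_iff_one_le_mul₀ (by positivity)]
            nlinarith [mul_le_mul_of_nonneg_left hδε₁ (show (0 : ℝ) ≤ 2 * δ by linarith),
              mul_nonneg hε₀.le (sq_nonneg (2 * δ))]
          linarith
        have h6 : ((1 - ε) * m s) * ((1 - ε) * (2 * δ)) ≤ m s * (m s - m t) := by
          refine le_trans ?_ h1
          have : 0 ≤ (1 - ε) * (2 * δ) := mul_nonneg (by linarith) (by linarith)
          exact mul_le_mul hc h2 this (by linarith)
        refine le_of_mul_le_mul_left (le_trans (le_of_eq ?_) h6) hs0
        ring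
      · have h1 : ε * m β ≤ m s - m t := by nlinarith
        have h2 : (1 - ε) ^ 2 ≤ 1 := pow_le_one₀ (by linarith) (by linarith)
        nlinarith
    have hsum : ∀ k : ℕ, k ≤ n → k * ((1 - ε) ^ 2 * (2 * δ)) ≤ m α - m (α + k * δ) := by
      intro k
      induction k with
      | zero => simp
      | succ k ih =>
        intro hk
        have h1 := ih (by omega)
        have hkn : ((k + 1 : ℕ) : ℝ) ≤ n := by exact_mod_cast hk
        have h2 := step (α + k * δ) (α + (k + 1 : ℕ) * δ)
          (by have : 0 ≤ k * δ := by positivity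
              linarith) (by push_cast; ring) (by nlinarith)
        push_cast at h2 ⊢
        linarith
    have := hsum n le_rfl
    rw [hδn, add_sub_cancel] at this
    calc (1 - ε) ^ 2 * (2 * (β - α)) = n * ((1 - ε) ^ 2 * (2 * δ)) := by rw [← hδn]; ring
      _ ≤ m α - m β := this
  have hlim : Filter.Tendsto (fun ε : ℝ => (1 - ε) ^ 2 * (2 * (β - α)))
      (nhdsWithin 0 (Set.Ioi 0)) (nhds ((1 - 0) ^ 2 * (2 * (β - α)))) :=
    ((Continuous.tendsto (by fun_prop) _)).mono_left nhdsWithin_le_nhds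
  rw [sub_zero, one_pow, one_mul] at hlim
  refine le_of_tendsto hlim ?_
  filter_upwards [Ioo_mem_nhdsGT zero_lt_one] with ε hε using main ε hε

theorem muFock_eq {f : ℂ → ℂ} {κ : ℝ} (hκ : 0 ≤ κ) :
    muFock f κ = volume.real {z | κ ^ 2 < sqFock f z} := by
  rw [muFock, measureReal_def]
  congr 3 with z
  rw [← uFock_sq, pow_lt_pow_iff_left₀ hκ (uFock_nonneg f z) two_ne_zero]

theorem monotoneOn_neg_two_mul_log_sub_muFock {f : ℂ → ℂ} (hf : Differentiable ℂ f)
    (hint : Integrable (sqFock f)) :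
    MonotoneOn (fun κ => -2 * Real.log κ - muFock f κ) (Set.Ioo 0 (⨆ z : ℂ, uFock f z)) := by
  rintro κ₁ ⟨h₁, -⟩ κ₂ ⟨h₂, hsup⟩ h₁₂
  have hpos : ∀ κ, 0 < κ → κ ≤ κ₂ → volume {z | κ ^ 2 < sqFock f z} ≠ 0 := by
    intro κ hκ hle
    obtain ⟨z, hz⟩ := exists_lt_of_lt_ciSup hsup
    refine (IsOpen.measure_pos _ (isOpen_lt continuous_const
      (continuous_sqFock hf.continuous)) ⟨z, ?_⟩).ne'
    change κ ^ 2 < sqFock f z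
    rw [← uFock_sq]
    exact pow_lt_pow_left₀ (hle.trans_lt hz) hκ.le two_ne_zero
  have hexp : ∀ t, Real.exp t ^ 2 = Real.exp (2 * t) := fun t => by
    rw [← Real.exp_nat_mul]; norm_num
  have key := two_mul_sub_le_of_forall_mul_le (m := fun t => muFock f (Real.exp t))
    (Real.log_le_log h₁ h₁₂)
    (by
      rw [Real.exp_log h₂, muFock_eq h₂.le]
      exact ENNReal.toReal_pos (hpos _ h₂ le_rfl)
        (volume_lt_sqFock_ne_top hf hint (by positivity)))
    (by
      intro s _ t _ hst
      simp only [muFock_eq (Real.exp_pos _).le]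
      refine measureReal_mono (fun z (hz : Real.exp t ^ 2 < sqFock f z) =>
        show Real.exp s ^ 2 < sqFock f z from lt_of_le_of_lt (by gcongr) hz)
        (volume_lt_sqFock_ne_top hf hint (by positivity)))
    (by
      intro s t _ hst ht
      have hst' : Real.exp s ^ 2 < Real.exp t ^ 2 := by gcongr
      have h := volume_mul_sub_le hf hint (by positivity) hst'
        (hpos _ (Real.exp_pos t) ((Real.le_log_iff_exp_le h₂).1 ht))
      simp only [muFock_eq (Real.exp_pos _).le]
      have e : Real.exp t ^ 2 - Real.exp s ^ 2 =
          Real.exp t ^ 2 * (1 - Real.exp (-(2 * (t - s)))) := by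
        rw [hexp, hexp, mul_sub, mul_one, ← Real.exp_add]
        ring_nf
      rw [e, mul_left_comm] at h
      exact le_of_mul_le_mul_left h (by positivity))
  simp only [Real.exp_log h₁, Real.exp_log h₂] at key ⊢
  linarith

theorem uFock_of_mem_fockOpt {f : ℂ → ℂ} (hf : f ∈ fockOpt) :
    ∃ w, ∀ z, uFock f z = Real.exp (-(Real.pi * ‖z - w‖ ^ 2 / 2)) := by
  obtain ⟨w, θ, rfl⟩ := hf
  refine ⟨w, fun z => ?_⟩
  rw [uFock, norm_mul, mul_comm Complex.I, Complex.norm_exp_ofReal_mul_I, one_mul,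
    Complex.norm_exp, ← Real.exp_add]
  congr 1
  simp only [Complex.sq_norm, Complex.normSq_apply]
  simp
  ring

theorem muFock_of_mem_fockOpt {f : ℂ → ℂ} (hf : f ∈ fockOpt) {κ : ℝ}
    (hκ : κ ∈ Set.Ioo 0 (⨆ z : ℂ, uFock f z)) : muFock f κ = -2 * Real.log κ := by
  obtain ⟨w, hw⟩ := uFock_of_mem_fockOpt hf
  have hπ := Real.pi_pos
  have hκ1 : κ < 1 := by
    refine hκ.2.trans_le (ciSup_le fun z => ?_)
    rw [hw, Real.exp_le_one_iff]
    have : 0 ≤ Real.pi * ‖z - w‖ ^ 2 / 2 := by positivity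
    linarith
  have hlog : 0 < -2 * Real.log κ / Real.pi := by
    have := Real.log_neg hκ.1 hκ1
    exact div_pos (by linarith) hπ
  have hset : {z | κ < uFock f z} = Metric.ball w √(-2 * Real.log κ / Real.pi) := by
    ext z
    simp only [Set.mem_ofPred_eq, hw, Metric.mem_ball, dist_eq_norm]
    rw [← Real.log_lt_iff_lt_exp hκ.1, Real.lt_sqrt (norm_nonneg _), lt_div_iff₀ hπ]
    constructor <;> intro h <;> linarith
  rw [muFock, hset, Complex.volume_ball]
  simp only [ENNReal.toReal_mul, ENNReal.toReal_pow, ENNReal.toReal_ofReal (Real.sqrt_nonneg _),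
    Real.sq_sqrt hlog.le, ENNReal.coe_toReal, NNReal.coe_real_pi]
  field_simp

/-- **Lemma 2.3 (monotonicity lemma), Case 1.** For `f ∈ F²(ℂ)`, the function
`κ ↦ −2 ln κ − μ(κ)`, where `μ(κ) = |{u_f > κ}|`, is nondecreasing on `(0, sup u_f)`;
if `f ∈ M₁` it is constant there. -/
theorem mono_fock (f : ℂ → ℂ) (hf : Differentiable ℂ f)
    (hint : Integrable (fun z : ℂ => ‖f z‖^2 * Real.exp (-Real.pi * ‖z‖^2))) :
    MonotoneOn (fun κ => -2 * Real.log κ - muFock f κ)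
      (Set.Ioo 0 (⨆ z : ℂ, uFock f z)) ∧
    (f ∈ fockOpt →
      ∀ κ₁ ∈ Set.Ioo 0 (⨆ z : ℂ, uFock f z), ∀ κ₂ ∈ Set.Ioo 0 (⨆ z : ℂ, uFock f z),
        -2 * Real.log κ₁ - muFock f κ₁ = -2 * Real.log κ₂ - muFock f κ₂) := by
  refine ⟨monotoneOn_neg_two_mul_log_sub_muFock hf hint, fun hopt κ₁ h₁ κ₂ h₂ => ?_⟩
  rw [muFock_of_mem_fockOpt hopt h₁, muFock_of_mem_fockOpt hopt h₂, sub_self, sub_self]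
end
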